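/- Assume (A3) and (A6), and assume that the unique solution (f₋, f₊) of Luckock's equation satisfies ε := min(f₋(I₋), f₊(I₊)) > 0. Let F⁽⁻⁾ be the linear functional with weights w⁽⁻⁾₋(x) := u₋₊(x)/λ₊(I₋) and w⁽⁻⁾₊(x) := −(1 − u₊₋(x))/λ₊(I₋) (x ∈ I), let F⁽⁺⁾ be the linear functional with weights w⁽⁺⁾₋(x) := −(1 − u₋₊(x))/λ₋(I₊) and w⁽⁺⁾₊(x) := u₊₋(x)/λ₋(I₊) (x ∈ I), and define V(X) := sqrt( max(F⁽⁻⁾(X), 0)² + max(F⁽⁺⁾(X), 0)² ). Then there exists a constant K < ∞ such that GV(X) ≤ K for every configuration X, and for each ε′ < ε there exists N < ∞ such that GV(X) ≤ −ε′ whenever the total number of points |X⁻| + |X⁺| is at least N. -/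

import Mathlib

open MeasureTheory Set
open scoped ENNReal

noncomputable section

/-- The right limit of `f` at `x`, with the convention `f(b+) := f b` at the
right endpoint `b`. -/
def rLim (b : ℝ) (f : ℝ → ℝ) (x : ℝ) : ℝ :=
  if x < b then Function.rightLim f x else f b

/-- `ν` is the Lebesgue-Stieltjes signed measure `df` of `f` on the interval `[a,b]`,
with the conventions `f(a−) := f a` and `f(b+) := f b`. -/
def IsLS (a b : ℝ) (f : ℝ → ℝ) (ν : MeasureTheory.SignedMeasure ℝ) : Prop :=
  (∀ s : Set ℝ, MeasurableSet s → s ∩ Set.Icc a b = ∅ → ν s = 0) ∧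
  (∀ x y : ℝ, a ≤ x → x ≤ y → y ≤ b → ν (Set.Ioc x y) = rLim b f y - rLim b f x) ∧
  ν {a} = rLim b f a - f a

/-- The integral `∫_s g dν` of `g` over `s` against the signed measure `ν`. -/
def sInt (ν : MeasureTheory.SignedMeasure ℝ) (g : ℝ → ℝ) (s : Set ℝ) : ℝ :=
  (∫ x in s, g x ∂ν.toJordanDecomposition.posPart) -
    ∫ x in s, g x ∂ν.toJordanDecomposition.negPart

/-- Assumption (A3): `lm` (demand) is continuous and nonincreasing, `lp` (supply) is
continuous and nondecreasing on `[a,b]`; both are nonnegative. -/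
def A3 (a b : ℝ) (lm lp : ℝ → ℝ) : Prop :=
  ContinuousOn lm (Set.Icc a b) ∧ ContinuousOn lp (Set.Icc a b) ∧
  AntitoneOn lm (Set.Icc a b) ∧ MonotoneOn lp (Set.Icc a b) ∧
  (∀ x ∈ Set.Icc a b, 0 ≤ lm x) ∧ (∀ x ∈ Set.Icc a b, 0 ≤ lp x)

/-- Assumption (A6): the rates of market orders are positive. -/
def A6 (a b : ℝ) (lm lp : ℝ → ℝ) : Prop := 0 < lp a ∧ 0 < lm b

/-- `(fm, fp)` is a solution of Luckock's equation on `[a,b]` for demand/supply `lm, lp`: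
both are continuous of bounded variation, `fm dlp + lm dfp = 0` and `fp dlm + lp dfm = 0`
as signed measures on `[a,b]`, and `fm b = 1 = fp a`. -/
def LuckockSol (a b : ℝ) (lm lp fm fp : ℝ → ℝ) : Prop :=
  ContinuousOn fm (Set.Icc a b) ∧ ContinuousOn fp (Set.Icc a b) ∧
  BoundedVariationOn fm (Set.Icc a b) ∧ BoundedVariationOn fp (Set.Icc a b) ∧
  fm b = 1 ∧ fp a = 1 ∧
  ∀ νlm νlp νfm νfp : MeasureTheory.SignedMeasure ℝ,
    IsLS a b lm νlm → IsLS a b lp νlp → IsLS a b fm νfm → IsLS a b fp νfp →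
    ∀ s : Set ℝ, MeasurableSet s →
      sInt νlp fm s + sInt νfp lm s = 0 ∧ sInt νlm fp s + sInt νfm lp s = 0

/-- The state of the order book: the multiset of buy limit order prices and the
multiset of sell limit order prices. -/
structure OrderBook where
  minus : Multiset ℝ
  plus : Multiset ℝ

/-- A valid configuration on the interval `(a,b)`: all orders have prices in `(a,b)`
and every buy order is strictly below every sell order. -/
def IsConfig (a b : ℝ) (X : OrderBook) : Prop :=
  (∀ x ∈ X.minus, x ∈ Set.Ioo a b) ∧ (∀ x ∈ X.plus, x ∈ Set.Ioo a b) ∧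
  ∀ x ∈ X.minus, ∀ y ∈ X.plus, x < y

/-- The best (highest) buy offer, `a` if there are no buy limit orders. -/
def Mminus (a : ℝ) (X : OrderBook) : ℝ := sSup (insert a {x | x ∈ X.minus})

/-- The best (lowest) sell offer, `b` if there are no sell limit orders. -/
def Mplus (b : ℝ) (X : OrderBook) : ℝ := sInf (insert b {x | x ∈ X.plus})

open scoped Classical in
/-- The Luckock map for a buy order at price level `u` (`u = b` is a buy market order). -/
def Lminus (a b u : ℝ) (X : OrderBook) : OrderBook :=
  if X.plus ≠ 0 ∧ Mplus b X ≤ u then ⟨X.minus, X.plus.erase (Mplus b X)⟩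
  else if u ∈ Set.Ioo a b then ⟨u ::ₘ X.minus, X.plus⟩ else X

open scoped Classical in
/-- The Luckock map for a sell order at price level `u` (`u = a` is a sell market order). -/
def Lplus (a b u : ℝ) (X : OrderBook) : OrderBook :=
  if X.minus ≠ 0 ∧ u ≤ Mminus a X then ⟨X.minus.erase (Mminus a X), X.plus⟩
  else if u ∈ Set.Ioo a b then ⟨X.minus, u ::ₘ X.plus⟩ else X

/-- The linear functional associated with the weight functions `wm, wp`. -/
def linF (wm wp : ℝ → ℝ) (X : OrderBook) : ℝ :=
  (X.minus.map wm).sum + (X.plus.map wp).sum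

/-- The generator of the Stigler-Luckock model with arrival measures `μm, μp`. -/
def genOp (a b : ℝ) (μm μp : MeasureTheory.Measure ℝ) (F : OrderBook → ℝ)
    (X : OrderBook) : ℝ :=
  (∫ u, (F (Lminus a b u X) - F X) ∂μm) + ∫ u, (F (Lplus a b u X) - F X) ∂μp

/-- `μm` is the arrival measure of buy orders: `μm [x, b] = lm x`, supported on `[a,b]`. -/
def IsMuMinus (a b : ℝ) (lm : ℝ → ℝ) (μm : MeasureTheory.Measure ℝ) : Prop :=
  (∀ x ∈ Set.Icc a b, μm (Set.Icc x b) = ENNReal.ofReal (lm x)) ∧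
  μm (Set.Icc a b)ᶜ = 0

/-- `μp` is the arrival measure of sell orders: `μp [a, x] = lp x`, supported on `[a,b]`. -/
def IsMuPlus (a b : ℝ) (lp : ℝ → ℝ) (μp : MeasureTheory.Measure ℝ) : Prop :=
  (∀ x ∈ Set.Icc a b, μp (Set.Icc a x) = ENNReal.ofReal (lp x)) ∧
  μp (Set.Icc a b)ᶜ = 0

/-- The constant `Γ`, computed from the Lebesgue-Stieltjes measure `νip` of `1/λ₊`. -/
def Gam (a b : ℝ) (lm lp : ℝ → ℝ) (νip : MeasureTheory.SignedMeasure ℝ) : ℝ :=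
  (lm b * lp b)⁻¹ - sInt νip (fun x => (lm x)⁻¹) (Set.Icc a b)

/-- The function `u₋₊`, where `νip` is the Lebesgue-Stieltjes measure of `1/λ₊`. -/
def ump (a b : ℝ) (lm lp : ℝ → ℝ) (νip : MeasureTheory.SignedMeasure ℝ) (x : ℝ) : ℝ :=
  (Gam a b lm lp νip)⁻¹ *
    ((lm b * lp b)⁻¹ - sInt νip (fun t => (lm t)⁻¹) (Set.Ioc x b))

/-- The function `u₊₋`, where `νim` is the Lebesgue-Stieltjes measure of `1/λ₋`. -/
def upm (a b : ℝ) (lm lp : ℝ → ℝ) (νip νim : MeasureTheory.SignedMeasure ℝ) (x : ℝ) : ℝ :=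
  (Gam a b lm lp νip)⁻¹ *
    ((lm a * lp a)⁻¹ + sInt νim (fun t => (lp t)⁻¹) (Set.Ioc a x))

/-- The linear functional `F⁽⁻⁾`, with weights `w⁽⁻⁾₋ = u₋₊/λ₊(a)` and
`w⁽⁻⁾₊ = −(1−u₊₋)/λ₊(a)`. -/
def Fminus (a b : ℝ) (lm lp : ℝ → ℝ) (νip νim : MeasureTheory.SignedMeasure ℝ)
    (X : OrderBook) : ℝ :=
  linF (fun x => ump a b lm lp νip x / lp a)
    (fun x => -((1 - upm a b lm lp νip νim x) / lp a)) X

/-- The linear functional `F⁽⁺⁾`, with weights `w⁽⁺⁾₋ = −(1−u₋₊)/λ₋(b)` and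
`w⁽⁺⁾₊ = u₊₋/λ₋(b)`. -/
def Fplus (a b : ℝ) (lm lp : ℝ → ℝ) (νip νim : MeasureTheory.SignedMeasure ℝ)
    (X : OrderBook) : ℝ :=
  linF (fun x => -((1 - ump a b lm lp νip x) / lm b))
    (fun x => upm a b lm lp νip νim x / lm b) X

/-- The Lyapunov function `V(X) = sqrt((F⁽⁻⁾(X) ∨ 0)² + (F⁽⁺⁾(X) ∨ 0)²)`. -/
def LyapV (a b : ℝ) (lm lp : ℝ → ℝ) (νip νim : MeasureTheory.SignedMeasure ℝ)
    (X : OrderBook) : ℝ :=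
  Real.sqrt (max (Fminus a b lm lp νip νim X) 0 ^ 2 +
    max (Fplus a b lm lp νip νim X) 0 ^ 2)

namespace Luckock

open Filter Topology

/-- The interval function `φ` is negligible compared with `T`, uniformly over short subintervals
of `[a, b]`. -/
def Negl (a b : ℝ) (T : Measure ℝ) (φ : ℝ → ℝ → ℝ) : Prop :=
  ∀ η > 0, ∃ δ > 0, ∀ x y, a ≤ x → x ≤ y → y ≤ b → y - x < δ → |φ x y| ≤ η * T.real (Ioc x y)

section Negl

variable {a b : ℝ} {T : Measure ℝ}

lemma measureReal_Ioc_add [IsFiniteMeasure T] {x y z : ℝ} (hxy : x ≤ y) (hyz : y ≤ z) :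
    T.real (Ioc x z) = T.real (Ioc x y) + T.real (Ioc y z) := by
  rw [← Ioc_union_Ioc_eq_Ioc hxy hyz, measureReal_union (Ioc_disjoint_Ioc_of_le le_rfl)
    measurableSet_Ioc]

lemma le_of_local [IsFiniteMeasure T] {Φ : ℝ → ℝ}
    (h : ∀ η > 0, ∃ δ > 0, ∀ x y, a ≤ x → x ≤ y → y ≤ b → y - x < δ →
      Φ y - Φ x ≤ η * T.real (Ioc x y))
    {x y : ℝ} (hx : a ≤ x) (hxy : x ≤ y) (hy : y ≤ b) : Φ y ≤ Φ x := by
  have key : ∀ η > 0, Φ y - Φ x ≤ η * T.real (Ioc x y) := by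
    intro η hη
    obtain ⟨δ, hδ, H⟩ := h η hη
    have ind : ∀ n : ℕ, ∀ z, x ≤ z → z ≤ b → z - x < n * (δ / 2) →
        Φ z - Φ x ≤ η * T.real (Ioc x z) := by
      intro n
      induction n with
      | zero => intro z hz _ h0; simp at h0; linarith
      | succ n ih =>
        intro z hz hzb hlt
        by_cases hs : z - x < δ
        · exact H x z hx hz hzb hs
        · push Not at hs
          push_cast at hlt
          have h1 := ih (z - δ / 2) (by linarith) (by linarith) (by linarith)
          have h2 := H (z - δ / 2) z (by linarith) (by linarith) hzb (by linarith)
          rw [measureReal_Ioc_add (y := z - δ / 2) (by linarith) (by linarith)]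
          linarith
    obtain ⟨n, hn⟩ := exists_nat_gt ((y - x) / (δ / 2))
    exact ind n y hxy hy ((div_lt_iff₀ (by positivity)).1 hn)
  by_contra! hlt
  have hT : 0 ≤ T.real (Ioc x y) := measureReal_nonneg
  have := key ((Φ y - Φ x) / (2 * (T.real (Ioc x y) + 1))) (by apply div_pos <;> linarith)
  rw [div_mul_eq_mul_div, le_div_iff₀ (by positivity)] at this
  nlinarith

lemma Negl.const [IsFiniteMeasure T] {Φ : ℝ → ℝ} (h : Negl a b T fun x y => Φ y - Φ x)
    {x y : ℝ} (hx : x ∈ Icc a b) (hy : y ∈ Icc a b) : Φ x = Φ y := by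
  have main : ∀ x y, a ≤ x → x ≤ y → y ≤ b → Φ x = Φ y := by
    intro x y hx hxy hy
    apply le_antisymm
    · have := le_of_local (T := T) (a := a) (b := b) (Φ := fun t => -Φ t) (fun η hη => by
        obtain ⟨δ, hδ, H⟩ := h η hη
        refine ⟨δ, hδ, fun x y h1 h2 h3 h4 => ?_⟩
        have := (abs_le.1 (H x y h1 h2 h3 h4)).1
        linarith) hx hxy hy
      simpa using this
    · exact le_of_local (T := T) (a := a) (b := b) (fun η hη => by
        obtain ⟨δ, hδ, H⟩ := h η hη
        exact ⟨δ, hδ, fun x y h1 h2 h3 h4 => (abs_le.1 (H x y h1 h2 h3 h4)).2⟩) hx hxy hy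
  rcases le_total x y with hxy | hxy
  · exact main x y hx.1 hxy hy.2
  · exact (main y x hy.1 hxy hx.2).symm

lemma Negl.congr {φ ψ : ℝ → ℝ → ℝ} (h : Negl a b T φ)
    (he : ∀ x y, a ≤ x → x ≤ y → y ≤ b → ψ x y = φ x y) : Negl a b T ψ := by
  intro η hη
  obtain ⟨δ, hδ, H⟩ := h η hη
  exact ⟨δ, hδ, fun x y h1 h2 h3 h4 => by rw [he x y h1 h2 h3]; exact H x y h1 h2 h3 h4⟩

lemma Negl.add {φ ψ : ℝ → ℝ → ℝ} (h : Negl a b T φ) (h' : Negl a b T ψ) :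
    Negl a b T fun x y => φ x y + ψ x y := by
  intro η hη
  obtain ⟨δ, hδ, H⟩ := h (η / 2) (by positivity)
  obtain ⟨δ', hδ', H'⟩ := h' (η / 2) (by positivity)
  refine ⟨min δ δ', lt_min hδ hδ', fun x y h1 h2 h3 h4 => ?_⟩
  have := H x y h1 h2 h3 (h4.trans_le (min_le_left _ _))
  have := H' x y h1 h2 h3 (h4.trans_le (min_le_right _ _))
  have := abs_add_le (φ x y) (ψ x y)
  linarith

lemma Negl.mul {φ : ℝ → ℝ → ℝ} (h : Negl a b T φ) {g : ℝ → ℝ}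
    (hg : ContinuousOn g (Icc a b)) : Negl a b T fun x y => g x * φ x y := by
  obtain ⟨C, hC⟩ := isCompact_Icc.exists_bound_of_continuousOn hg
  intro η hη
  obtain ⟨δ, hδ, H⟩ := h (η / (|C| + 1)) (by positivity)
  refine ⟨δ, hδ, fun x y h1 h2 h3 h4 => ?_⟩
  have h5 := H x y h1 h2 h3 h4
  have h6 := hC x ⟨h1, h2.trans h3⟩
  rw [Real.norm_eq_abs] at h6
  rw [abs_mul]
  have h7 : |g x| ≤ |C| + 1 := by linarith [le_abs_self C]
  calc |g x| * |φ x y| ≤ (|C| + 1) * (η / (|C| + 1) * T.real (Ioc x y)) := by gcongr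
    _ = η * T.real (Ioc x y) := by field_simp

lemma Negl.const_mul {φ : ℝ → ℝ → ℝ} (h : Negl a b T φ) (c : ℝ) :
    Negl a b T fun x y => c * φ x y :=
  h.mul (g := fun _ => c) continuousOn_const

lemma exists_delta {g : ℝ → ℝ} (hg : ContinuousOn g (Icc a b)) {η : ℝ} (hη : 0 < η) :
    ∃ δ > 0, ∀ x ∈ Icc a b, ∀ y ∈ Icc a b, |y - x| < δ → |g y - g x| < η := by
  have := isCompact_Icc.uniformContinuousOn_of_continuous hg
  obtain ⟨δ, hδ, H⟩ := Metric.uniformContinuousOn_iff.1 this η hη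
  exact ⟨δ, hδ, fun x hx y hy h => H y hy x hx h⟩

lemma negl_mul_increment {f g : ℝ → ℝ} (hf : ContinuousOn f (Icc a b))
    (hg : ∀ x y, a ≤ x → x ≤ y → y ≤ b → |g y - g x| ≤ T.real (Ioc x y)) :
    Negl a b T fun x y => (f y - f x) * (g y - g x) := by
  intro η hη
  obtain ⟨δ, hδ, H⟩ := exists_delta hf hη
  refine ⟨δ, hδ, fun x y h1 h2 h3 h4 => ?_⟩
  have h5 := H x ⟨h1, h2.trans h3⟩ y ⟨h1.trans h2, h3⟩
    (by rwa [abs_of_nonneg (by linarith)])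
  rw [abs_mul]
  exact mul_le_mul h5.le (hg x y h1 h2 h3) (abs_nonneg _) hη.le

/-- If `dS = g df` with `f` nondecreasing and `0 ≤ g ≤ C`, then `0 ≤ dS ≤ C df`. -/
lemma increment_bounds [IsFiniteMeasure T] {S f g : ℝ → ℝ} {C : ℝ}
    (h : Negl a b T fun x y => (S y - S x) - g x * (f y - f x)) (hf : MonotoneOn f (Icc a b))
    (hg : ∀ x ∈ Icc a b, 0 ≤ g x ∧ g x ≤ C) {x y : ℝ} (hx : a ≤ x) (hxy : x ≤ y) (hy : y ≤ b) :
    0 ≤ S y - S x ∧ S y - S x ≤ C * (f y - f x) := by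
  constructor
  · have := le_of_local (T := T) (a := a) (b := b) (Φ := fun t => -S t) (fun η hη => by
      obtain ⟨δ, hδ, H⟩ := h η hη
      refine ⟨δ, hδ, fun x y h1 h2 h3 h4 => ?_⟩
      have h5 := (abs_le.1 (H x y h1 h2 h3 h4)).1
      have h6 := hf ⟨h1, h2.trans h3⟩ ⟨h1.trans h2, h3⟩ h2
      have h7 := mul_nonneg (hg x ⟨h1, h2.trans h3⟩).1 (sub_nonneg.2 h6)
      linarith) hx hxy hy
    linarith
  · have := le_of_local (T := T) (a := a) (b := b) (Φ := fun t => S t - C * f t) (fun η hη => by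
      obtain ⟨δ, hδ, H⟩ := h η hη
      refine ⟨δ, hδ, fun x y h1 h2 h3 h4 => ?_⟩
      have h5 := (abs_le.1 (H x y h1 h2 h3 h4)).2
      have h6 := hf ⟨h1, h2.trans h3⟩ ⟨h1.trans h2, h3⟩ h2
      have h7 := mul_nonneg (sub_nonneg.2 (hg x ⟨h1, h2.trans h3⟩).2) (sub_nonneg.2 h6)
      linarith) hx hxy hy
    linarith

lemma continuousOn_of_increment_le {S f : ℝ → ℝ} {C : ℝ} (hf : ContinuousOn f (Icc a b))
    (h : ∀ x y, a ≤ x → x ≤ y → y ≤ b → |S y - S x| ≤ C * |f y - f x|) :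
    ContinuousOn S (Icc a b) := by
  have h' : ∀ x ∈ Icc a b, ∀ y ∈ Icc a b, |S y - S x| ≤ C * |f y - f x| := by
    intro x hx y hy
    rcases le_total x y with hxy | hxy
    · exact h x y hx.1 hxy hy.2
    · rw [abs_sub_comm, abs_sub_comm (f y)]; exact h y x hy.1 hxy hx.2
  intro x hx
  rw [ContinuousWithinAt, tendsto_iff_norm_sub_tendsto_zero]
  have h1 := (tendsto_iff_norm_sub_tendsto_zero.1 (hf x hx)).const_mul C
  rw [mul_zero] at h1
  refine squeeze_zero' (Eventually.of_forall fun _ => norm_nonneg _) ?_ h1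
  filter_upwards [self_mem_nhdsWithin] with y hy using h' x hx y hy

lemma abs_setIntegral_sub_le {μ : Measure ℝ} [IsFiniteMeasure μ] {g : ℝ → ℝ} {s : Set ℝ}
    {c η : ℝ} (hg : IntegrableOn g s μ) (h : ∀ x ∈ s, |g x - c| ≤ η) :
    |(∫ x in s, g x ∂μ) - c * μ.real s| ≤ η * μ.real s := by
  have h1 : (∫ x in s, g x ∂μ) - c * μ.real s = ∫ x in s, (g x - c) ∂μ := by
    rw [integral_sub hg (integrable_const c), setIntegral_const, smul_eq_mul, mul_comm]
  rw [h1, ← Real.norm_eq_abs]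
  exact norm_setIntegral_le_of_norm_le_const (measure_lt_top μ s) h

end Negl

section SignedMeasure

variable {a b : ℝ} {T : Measure ℝ} {f g : ℝ → ℝ} {ν : SignedMeasure ℝ}

lemma rLim_eq (hf : ContinuousOn f (Icc a b)) {x : ℝ} (hx : x ∈ Icc a b) : rLim b f x = f x := by
  unfold rLim
  split_ifs with h
  · apply rightLim_eq_of_tendsto
    have h1 : Tendsto f (𝓝[Icc x b] x) (𝓝 (f x)) := (hf x hx).mono (Icc_subset_Icc_left hx.1)
    have h2 : 𝓝[>] x ≤ 𝓝[Icc x b] x := by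
      rw [← nhdsWithin_Ioc_eq_nhdsGT h]
      exact nhdsWithin_mono _ Ioc_subset_Icc_self
    exact h1.mono_left h2
  · rw [le_antisymm hx.2 (not_lt.1 h)]

lemma isLS_apply_Ioc (hν : IsLS a b f ν) (hf : ContinuousOn f (Icc a b)) {x y : ℝ}
    (hx : a ≤ x) (hxy : x ≤ y) (hy : y ≤ b) : ν (Ioc x y) = f y - f x := by
  rw [hν.2.1 x y hx hxy hy, rLim_eq hf ⟨hx.trans hxy, hy⟩, rLim_eq hf ⟨hx, hxy.trans hy⟩]

lemma posPart_add_negPart_le [IsFiniteMeasure T] (hT : ν.totalVariation ≤ T) (s : Set ℝ) :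
    ν.toJordanDecomposition.posPart.real s + ν.toJordanDecomposition.negPart.real s
      ≤ T.real s := by
  rw [measureReal_def, measureReal_def, measureReal_def,
    ← ENNReal.toReal_add (measure_ne_top _ _) (measure_ne_top _ _)]
  exact ENNReal.toReal_mono (measure_ne_top _ _) (hT s)

lemma abs_increment_le (hν : IsLS a b f ν) (hf : ContinuousOn f (Icc a b)) [IsFiniteMeasure T]
    (hT : ν.totalVariation ≤ T) (x y : ℝ) (hx : a ≤ x) (hxy : x ≤ y) (hy : y ≤ b) :
    |f y - f x| ≤ T.real (Ioc x y) := by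
  rw [← isLS_apply_Ioc hν hf hx hxy hy,
    ν.apply_eq_posPart_real_sub_negPart_real measurableSet_Ioc]
  have h1 := posPart_add_negPart_le hT (Ioc x y)
  have h2 : 0 ≤ ν.toJordanDecomposition.posPart.real (Ioc x y) := measureReal_nonneg
  have h3 : 0 ≤ ν.toJordanDecomposition.negPart.real (Ioc x y) := measureReal_nonneg
  rw [abs_le]
  constructor <;> linarith

lemma integrableOn_of_continuousOn {μ : Measure ℝ} [IsFiniteMeasure μ]
    (hg : ContinuousOn g (Icc a b)) {s : Set ℝ} (hs : s ⊆ Icc a b) : IntegrableOn g s μ :=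
  (hg.integrableOn_compact isCompact_Icc).mono_set hs

lemma negl_sInt (hν : IsLS a b f ν) (hf : ContinuousOn f (Icc a b)) [IsFiniteMeasure T]
    (hT : ν.totalVariation ≤ T) (hg : ContinuousOn g (Icc a b)) :
    Negl a b T fun x y => sInt ν g (Ioc x y) - g x * (f y - f x) := by
  intro η hη
  obtain ⟨δ, hδ, H⟩ := exists_delta hg hη
  refine ⟨δ, hδ, fun x y h1 h2 h3 h4 => ?_⟩
  have hs : Ioc x y ⊆ Icc a b := fun t ht => ⟨h1.trans ht.1.le, ht.2.trans h3⟩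
  have hosc : ∀ t ∈ Ioc x y, |g t - g x| ≤ η := fun t ht =>
    (H x ⟨h1, h2.trans h3⟩ t (hs ht) (by
      rw [abs_of_nonneg (by linarith [ht.1])]; linarith [ht.2])).le
  have hp := abs_setIntegral_sub_le (μ := ν.toJordanDecomposition.posPart)
    (integrableOn_of_continuousOn hg hs) hosc
  have hn := abs_setIntegral_sub_le (μ := ν.toJordanDecomposition.negPart)
    (integrableOn_of_continuousOn hg hs) hosc
  have hsum := mul_le_mul_of_nonneg_left (posPart_add_negPart_le hT (Ioc x y)) hη.le
  beta_reduce
  rw [← isLS_apply_Ioc hν hf h1 h2 h3,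
    ν.apply_eq_posPart_real_sub_negPart_real measurableSet_Ioc, sInt]
  rw [abs_le] at hp hn ⊢
  constructor <;> linarith

lemma sInt_Ioc_sub (hg : ContinuousOn g (Icc a b)) {c x y : ℝ} (hc : a ≤ c) (hx : c ≤ x)
    (hxy : x ≤ y) (hy : y ≤ b) :
    sInt ν g (Ioc c y) - sInt ν g (Ioc c x) = sInt ν g (Ioc x y) := by
  have h1 : ∀ u v, a ≤ u → v ≤ b → Ioc u v ⊆ Icc a b := fun u v hu hv t ht =>
    ⟨hu.trans ht.1.le, ht.2.trans hv⟩
  have h2 : ∀ μ : Measure ℝ, IsFiniteMeasure μ →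
      ∫ t in Ioc c y, g t ∂μ = (∫ t in Ioc c x, g t ∂μ) + ∫ t in Ioc x y, g t ∂μ := by
    intro μ _
    rw [← Ioc_union_Ioc_eq_Ioc hx hxy, setIntegral_union (Ioc_disjoint_Ioc_of_le le_rfl)
      measurableSet_Ioc (integrableOn_of_continuousOn hg (h1 _ _ hc (hxy.trans hy)))
      (integrableOn_of_continuousOn hg (h1 _ _ (hc.trans hx) hy))]
  simp only [sInt]
  rw [h2 _ inferInstance, h2 _ inferInstance]
  ring

lemma sInt_Icc_eq (hab : a ≤ b) (hν : IsLS a b f ν) (hf : ContinuousOn f (Icc a b))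
    (hg : ContinuousOn g (Icc a b)) : sInt ν g (Icc a b) = sInt ν g (Ioc a b) := by
  have h0 : ν {a} = 0 := by
    rw [hν.2.2, rLim_eq hf (left_mem_Icc.2 hab), sub_self]
  rw [ν.apply_eq_posPart_real_sub_negPart_real (measurableSet_singleton a)] at h0
  have h2 : ∀ μ : Measure ℝ, IsFiniteMeasure μ →
      ∫ t in Icc a b, g t ∂μ = μ.real {a} * g a + ∫ t in Ioc a b, g t ∂μ := by
    intro μ _
    rw [← Icc_union_Ioc_eq_Icc le_rfl hab, setIntegral_union (by simp)
      measurableSet_Ioc (integrableOn_of_continuousOn hg (by simpa using hab))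
      (integrableOn_of_continuousOn hg Ioc_subset_Icc_self), Icc_self, integral_singleton,
      smul_eq_mul]
  simp only [sInt]
  rw [h2 _ inferInstance, h2 _ inferInstance, sub_eq_zero.1 h0]
  ring

lemma exists_isLS (hab : a ≤ b) (hf : ContinuousOn f (Icc a b))
    (hbv : BoundedVariationOn f (Icc a b)) : ∃ ν, IsLS a b f ν := by
  let φ : ℝ → ℝ := IccExtend hab ((Icc a b).domRestrict f)
  have hφ : Continuous φ := hf.domRestrict.Icc_extend'
  have hφeq : ∀ x ∈ Icc a b, φ x = f x := fun x hx => IccExtend_of_mem hab _ hx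
  have hφbv : BoundedVariationOn φ univ := by
    have h1 : φ = f ∘ fun x => (projIcc a b hab x : ℝ) := rfl
    rw [h1, BoundedVariationOn]
    exact ne_top_of_le_ne_top hbv (eVariationOn.comp_le_of_monotoneOn f _
      (fun x _ y _ h => monotone_projIcc hab h) fun x _ => (projIcc a b hab x).2)
  have hr : ∀ x, Function.rightLim φ x = φ x := fun x =>
    hφ.continuousAt.continuousWithinAt.rightLim_eq
  have hl : ∀ x, Function.leftLim φ x = φ x := fun x =>
    hφ.continuousAt.continuousWithinAt.leftLim_eq
  refine ⟨hφbv.vectorMeasure.restrict (Icc a b), ?_, ?_, ?_⟩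
  · intro s hs h0
    rw [VectorMeasure.restrict_apply _ measurableSet_Icc hs, h0, VectorMeasure.empty]
  · intro x y hx hxy hy
    have hs : Ioc x y ⊆ Icc a b := fun t ht => ⟨hx.trans ht.1.le, ht.2.trans hy⟩
    rw [VectorMeasure.restrict_apply _ measurableSet_Icc measurableSet_Ioc,
      inter_eq_left.2 hs, hφbv.vectorMeasure_Ioc hxy, hr, hr, hφeq y ⟨hx.trans hxy, hy⟩,
      hφeq x ⟨hx, hxy.trans hy⟩, rLim_eq hf ⟨hx.trans hxy, hy⟩, rLim_eq hf ⟨hx, hxy.trans hy⟩]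
  · rw [VectorMeasure.restrict_apply _ measurableSet_Icc (measurableSet_singleton a),
      inter_eq_left.2 (by simpa using hab), hφbv.vectorMeasure_singleton, hr, hl,
      rLim_eq hf (left_mem_Icc.2 hab), sub_self, sub_self]

end SignedMeasure

section Potentials

variable {a b : ℝ} {T : Measure ℝ} {lm lp : ℝ → ℝ}

lemma A3.lm_pos (h : A3 a b lm lp) (h' : A6 a b lm lp) {x : ℝ} (hx : x ∈ Icc a b) : 0 < lm x :=
  h'.2.trans_le (h.2.2.1 hx (right_mem_Icc.2 (hx.1.trans hx.2)) hx.2)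

lemma A3.lp_pos (h : A3 a b lm lp) (h' : A6 a b lm lp) {x : ℝ} (hx : x ∈ Icc a b) : 0 < lp x :=
  h'.1.trans_le (h.2.2.2.1 (left_mem_Icc.2 (hx.1.trans hx.2)) hx hx.1)

lemma A3.continuousOn_inv_lm (h : A3 a b lm lp) (h' : A6 a b lm lp) :
    ContinuousOn (fun x => (lm x)⁻¹) (Icc a b) :=
  h.1.inv₀ fun _ hx => (A3.lm_pos h h' hx).ne'

lemma A3.continuousOn_inv_lp (h : A3 a b lm lp) (h' : A6 a b lm lp) :
    ContinuousOn (fun x => (lp x)⁻¹) (Icc a b) :=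
  h.2.1.inv₀ fun _ hx => (A3.lp_pos h h' hx).ne'

lemma A3.monotoneOn_inv_lm (h : A3 a b lm lp) (h' : A6 a b lm lp) :
    MonotoneOn (fun x => (lm x)⁻¹) (Icc a b) := fun _ hx _ hy hxy =>
  inv_anti₀ (A3.lm_pos h h' hy) (h.2.2.1 hx hy hxy)

lemma A3.antitoneOn_inv_lp (h : A3 a b lm lp) (h' : A6 a b lm lp) :
    AntitoneOn (fun x => (lp x)⁻¹) (Icc a b) := fun _ hx _ hy hxy =>
  inv_anti₀ (A3.lp_pos h h' hx) (h.2.2.2.1 hx hy hxy)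

/-- The properties of the pair `(p, q) = (u₋₊, u₊₋)` and the constant `G = Γ`. -/
structure IsPotential (a b : ℝ) (T : Measure ℝ) (lm lp : ℝ → ℝ) (G : ℝ) (p q : ℝ → ℝ) : Prop where
  G_pos : 0 < G
  cont_p : ContinuousOn p (Icc a b)
  cont_q : ContinuousOn q (Icc a b)
  anti_p : AntitoneOn p (Icc a b)
  mono_q : MonotoneOn q (Icc a b)
  p_left : p a = 1
  q_right : q b = 1
  add_eq : ∀ x ∈ Icc a b, p x + q x = 1 + G⁻¹ * ((lm x)⁻¹ * (lp x)⁻¹)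
  negl_p : Negl a b T fun x y =>
    (p y - p x) - G⁻¹ * (lm x)⁻¹ * ((lp y)⁻¹ - (lp x)⁻¹)
  negl_q : Negl a b T fun x y =>
    (q y - q x) - G⁻¹ * (lp x)⁻¹ * ((lm y)⁻¹ - (lm x)⁻¹)

theorem isPotential [IsFiniteMeasure T] (hab : a < b) (h3 : A3 a b lm lp) (h6 : A6 a b lm lp)
    {νip νim : SignedMeasure ℝ} (hνip : IsLS a b (fun x => (lp x)⁻¹) νip)
    (hνim : IsLS a b (fun x => (lm x)⁻¹) νim) (hTp : νip.totalVariation ≤ T)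
    (hTm : νim.totalVariation ≤ T) :
    IsPotential a b T lm lp (Gam a b lm lp νip) (ump a b lm lp νip) (upm a b lm lp νip νim) := by
  have ha : a ∈ Icc a b := left_mem_Icc.2 hab.le
  have hb : b ∈ Icc a b := right_mem_Icc.2 hab.le
  have hlm : ∀ x ∈ Icc a b, 0 < (lm x)⁻¹ := fun x hx => inv_pos.2 (A3.lm_pos h3 h6 hx)
  have hlp : ∀ x ∈ Icc a b, 0 < (lp x)⁻¹ := fun x hx => inv_pos.2 (A3.lp_pos h3 h6 hx)
  have cα := A3.continuousOn_inv_lm h3 h6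
  have cβ := A3.continuousOn_inv_lp h3 h6
  have mα := A3.monotoneOn_inv_lm h3 h6
  have mβ := A3.antitoneOn_inv_lp h3 h6
  set S : ℝ → ℝ := fun x => sInt νip (fun t => (lm t)⁻¹) (Ioc a x) with hS
  set R : ℝ → ℝ := fun x => sInt νim (fun t => (lp t)⁻¹) (Ioc a x) with hR
  have S_a : S a = 0 := by simp [hS, sInt]
  have R_a : R a = 0 := by simp [hR, sInt]
  have negl_S : Negl a b T fun x y => (S y - S x) - (lm x)⁻¹ * ((lp y)⁻¹ - (lp x)⁻¹) :=
    (negl_sInt hνip cβ hTp cα).congr fun x y hx hxy hy => by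
      rw [hS, sInt_Ioc_sub cα le_rfl hx hxy hy]
  have negl_R : Negl a b T fun x y => (R y - R x) - (lp x)⁻¹ * ((lm y)⁻¹ - (lm x)⁻¹) :=
    (negl_sInt hνim cα hTm cβ).congr fun x y hx hxy hy => by
      rw [hR, sInt_Ioc_sub cβ le_rfl hx hxy hy]
  have S_bd : ∀ x y, a ≤ x → x ≤ y → y ≤ b →
      0 ≤ -S y - -S x ∧ -S y - -S x ≤ (lm b)⁻¹ * (-(lp y)⁻¹ - -(lp x)⁻¹) := fun x y =>
    increment_bounds (T := T) (S := fun x => -S x) (f := fun x => -(lp x)⁻¹)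
      (g := fun x => (lm x)⁻¹)
      ((negl_S.const_mul (-1)).congr fun x y _ _ _ => by ring) (fun x hx y hy hxy =>
        neg_le_neg (mβ hx hy hxy)) (fun x hx => ⟨(hlm x hx).le, mα hx hb hx.2⟩)
  have R_bd : ∀ x y, a ≤ x → x ≤ y → y ≤ b →
      0 ≤ R y - R x ∧ R y - R x ≤ (lp a)⁻¹ * ((lm y)⁻¹ - (lm x)⁻¹) := fun x y =>
    increment_bounds (T := T) negl_R mα (fun x hx => ⟨(hlp x hx).le, mβ ha hx hx.1⟩)
  have cS : ContinuousOn S (Icc a b) := continuousOn_of_increment_le (C := (lm b)⁻¹) cβ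
    fun x y hx hxy hy => by
      have h1 := S_bd x y hx hxy hy
      have h2 := mβ ⟨hx, hxy.trans hy⟩ ⟨hx.trans hxy, hy⟩ hxy
      simp only at h2
      rw [abs_of_nonpos (by linarith), abs_of_nonpos (by linarith)]
      linarith
  have cR : ContinuousOn R (Icc a b) := continuousOn_of_increment_le (C := (lp a)⁻¹) cα
    fun x y hx hxy hy => by
      have h1 := R_bd x y hx hxy hy
      have h2 := mα ⟨hx, hxy.trans hy⟩ ⟨hx.trans hxy, hy⟩ hxy
      simp only at h2
      rw [abs_of_nonneg (by linarith), abs_of_nonneg (by linarith)]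
      linarith
  have prod : ∀ x ∈ Icc a b, R x + S x = (lm x)⁻¹ * (lp x)⁻¹ - (lm a)⁻¹ * (lp a)⁻¹ := by
    intro x hx
    have := Negl.const (T := T) (a := a) (b := b)
      (Φ := fun x => R x + S x - (lm x)⁻¹ * (lp x)⁻¹)
      (((negl_S.add negl_R).add ((negl_mul_increment cα (abs_increment_le hνip cβ hTp)).const_mul
        (-1))).congr fun x y _ _ _ => by ring) hx ha
    simp only [S_a, R_a] at this
    linarith
  have hG : Gam a b lm lp νip = (lm b)⁻¹ * (lp b)⁻¹ - S b := by
    rw [Gam, sInt_Icc_eq hab.le hνip cβ cα, mul_inv]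
  set G := Gam a b lm lp νip
  have G_pos : 0 < G := by
    have h1 := (S_bd a b le_rfl hab.le le_rfl).1
    have h2 := mul_pos (hlm b hb) (hlp b hb)
    rw [S_a] at h1
    rw [hG]; linarith
  have hp : ∀ x ∈ Icc a b, ump a b lm lp νip x = 1 + G⁻¹ * S x := by
    intro x hx
    have h1 : sInt νip (fun t => (lm t)⁻¹) (Ioc x b) = S b - S x :=
      (sInt_Ioc_sub cα le_rfl hx.1 hx.2 le_rfl).symm
    rw [ump, h1, mul_inv, show (lm b)⁻¹ * (lp b)⁻¹ - (S b - S x) = G + S x by rw [hG]; ring, mul_add,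
      inv_mul_cancel₀ G_pos.ne']
  have hq : ∀ x, upm a b lm lp νip νim x = G⁻¹ * ((lm a)⁻¹ * (lp a)⁻¹ + R x) := by
    intro x
    rw [upm, mul_inv]
  have hGinv : 0 < G⁻¹ := inv_pos.2 G_pos
  refine ⟨G_pos, ?_, ?_, ?_, ?_, ?_, ?_, ?_, ?_, ?_⟩
  · exact (continuousOn_const.add (continuousOn_const.mul cS)).congr hp
  · exact (continuousOn_const.mul (continuousOn_const.add cR)).congr fun x _ => hq x
  · intro x hx y hy hxy
    rw [hp x hx, hp y hy]
    have := mul_le_mul_of_nonneg_left (S_bd x y hx.1 hxy hy.2).1 hGinv.le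
    linarith
  · intro x hx y hy hxy
    rw [hq x, hq y]
    have := mul_le_mul_of_nonneg_left (R_bd x y hx.1 hxy hy.2).1 hGinv.le
    linarith
  · rw [hp a ha, S_a]; ring
  · rw [hq, show (lm a)⁻¹ * (lp a)⁻¹ + R b = G by rw [hG]; linarith [prod b hb],
      inv_mul_cancel₀ G_pos.ne']
  · intro x hx
    rw [hp x hx, hq, show (lm a)⁻¹ * (lp a)⁻¹ + R x = (lm x)⁻¹ * (lp x)⁻¹ - S x by
      linarith [prod x hx]]
    ring
  · refine (negl_S.const_mul G⁻¹).congr fun x y hx hxy hy => ?_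
    rw [hp x ⟨hx, hxy.trans hy⟩, hp y ⟨hx.trans hxy, hy⟩]
    ring
  · refine (negl_R.const_mul G⁻¹).congr fun x y hx hxy hy => ?_
    rw [hq, hq]
    ring

/-- First order expansion of the increments of `1/f`. -/
lemma negl_inv {f : ℝ → ℝ} (hf : ContinuousOn f (Icc a b)) (hf0 : ∀ x ∈ Icc a b, f x ≠ 0)
    (hT : ∀ x y, a ≤ x → x ≤ y → y ≤ b → |f y - f x| ≤ T.real (Ioc x y)) :
    Negl a b T fun x y => ((f y)⁻¹ - (f x)⁻¹) + (f x)⁻¹ ^ 2 * (f y - f x) := by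
  have hc : ContinuousOn (fun x => (f x)⁻¹) (Icc a b) := hf.inv₀ hf0
  refine (((negl_mul_increment hc hT).mul hc).const_mul (-1)).congr fun x y hx hxy hy => ?_
  have := hf0 x ⟨hx, hxy.trans hy⟩
  have := hf0 y ⟨hx.trans hxy, hy⟩
  field_simp
  ring

variable {G : ℝ} {p q : ℝ → ℝ} {μm μp : Measure ℝ}

lemma IsPotential.flow_minus_const [IsFiniteMeasure T] (h3 : A3 a b lm lp) (h6 : A6 a b lm lp)
    (hpot : IsPotential a b T lm lp G p q)
    (hlm : ∀ x y, a ≤ x → x ≤ y → y ≤ b → |lm y - lm x| ≤ T.real (Ioc x y)) {I : ℝ → ℝ}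
    (hI : Negl a b T fun x y => (I y - I x) + p x * (lm y - lm x)) {x y : ℝ}
    (hx : x ∈ Icc a b) (hy : y ∈ Icc a b) :
    I x + (1 - q x) * lm x = I y + (1 - q y) * lm y := by
  have hinv := negl_inv h3.1 (fun x hx => (A3.lm_pos h3 h6 hx).ne') hlm
  have hdq := (hpot.negl_q.add ((hinv.mul (A3.continuousOn_inv_lp h3 h6)).const_mul G⁻¹)).mul h3.1
  refine Negl.const (T := T) (Φ := fun x => I x + (1 - q x) * lm x)
    (((hI.add (hdq.const_mul (-1))).add
      ((negl_mul_increment hpot.cont_q hlm).const_mul (-1))).congr ?_) hx hy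
  intro x y hx hxy hy
  have hx' : x ∈ Icc a b := ⟨hx, hxy.trans hy⟩
  have h1 := hpot.add_eq x hx'
  have h2 : lm x * (lm x)⁻¹ = 1 := mul_inv_cancel₀ (A3.lm_pos h3 h6 hx').ne'
  linear_combination (-(lm y - lm x)) * h1 +
    (G⁻¹ * (lp x)⁻¹ * (lm x)⁻¹ * (lm y - lm x)) * h2

lemma IsPotential.flow_plus_const [IsFiniteMeasure T] (h3 : A3 a b lm lp) (h6 : A6 a b lm lp)
    (hpot : IsPotential a b T lm lp G p q)
    (hlp : ∀ x y, a ≤ x → x ≤ y → y ≤ b → |lp y - lp x| ≤ T.real (Ioc x y)) {I : ℝ → ℝ}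
    (hI : Negl a b T fun x y => (I y - I x) + q x * (lp y - lp x)) {x y : ℝ}
    (hx : x ∈ Icc a b) (hy : y ∈ Icc a b) :
    I x + (1 - p x) * lp x = I y + (1 - p y) * lp y := by
  have hinv := negl_inv h3.2.1 (fun x hx => (A3.lp_pos h3 h6 hx).ne') hlp
  have hdp := (hpot.negl_p.add ((hinv.mul (A3.continuousOn_inv_lm h3 h6)).const_mul G⁻¹)).mul h3.2.1
  refine Negl.const (T := T) (Φ := fun x => I x + (1 - p x) * lp x)
    (((hI.add (hdp.const_mul (-1))).add
      ((negl_mul_increment hpot.cont_p hlp).const_mul (-1))).congr ?_) hx hy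
  intro x y hx hxy hy
  have hx' : x ∈ Icc a b := ⟨hx, hxy.trans hy⟩
  have h1 := hpot.add_eq x hx'
  have h2 : lp x * (lp x)⁻¹ = 1 := mul_inv_cancel₀ (A3.lp_pos h3 h6 hx').ne'
  linear_combination (-(lp y - lp x)) * h1 +
    (G⁻¹ * (lm x)⁻¹ * (lp x)⁻¹ * (lp y - lp x)) * h2

/-- The values of the solution of Luckock's equation at the far endpoints. -/
lemma IsPotential.luckock_endpoints [IsFiniteMeasure T] (hab : a < b) (h3 : A3 a b lm lp)
    (h6 : A6 a b lm lp) (hpot : IsPotential a b T lm lp G p q)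
    (hlm : ∀ x y, a ≤ x → x ≤ y → y ≤ b → |lm y - lm x| ≤ T.real (Ioc x y))
    (hlp : ∀ x y, a ≤ x → x ≤ y → y ≤ b → |lp y - lp x| ≤ T.real (Ioc x y))
    (hα : ∀ x y, a ≤ x → x ≤ y → y ≤ b → |(lm y)⁻¹ - (lm x)⁻¹| ≤ T.real (Ioc x y))
    {fm fp : ℝ → ℝ} (cfm : ContinuousOn fm (Icc a b)) (cfp : ContinuousOn fp (Icc a b))
    (hfm : fm b = 1) (hfp : fp a = 1)
    (h1 : Negl a b T fun x y => fm x * (lp y - lp x) + lm x * (fp y - fp x))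
    (h2 : Negl a b T fun x y => fp x * (lm y - lm x) + lp x * (fm y - fm x)) :
    fm a = (lp a)⁻¹ * (G⁻¹ * ((lm b)⁻¹ + (lp a)⁻¹) - lm a) ∧
      fp b = (lm b)⁻¹ * (G⁻¹ * ((lm b)⁻¹ + (lp a)⁻¹) - lp b) := by
  have ha : a ∈ Icc a b := left_mem_Icc.2 hab.le
  have hb : b ∈ Icc a b := right_mem_Icc.2 hab.le
  have cα := A3.continuousOn_inv_lm h3 h6
  have cβ := A3.continuousOn_inv_lp h3 h6
  have hκ : ∀ x ∈ Icc a b, fm x * lp x + fp x * lm x = fm a * lp a + fp a * lm a := by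
    intro x hx
    refine Negl.const (T := T) (Φ := fun x => fm x * lp x + fp x * lm x)
      (((h1.add h2).add ((negl_mul_increment cfm hlp).add (negl_mul_increment cfp hlm))).congr
        fun x y _ _ _ => ?_) hx ha
    ring
  have hκb := hκ b hb
  set κ := fm a * lp a + fp a * lm a
  have hinv := negl_inv h3.1 (fun x hx => (A3.lm_pos h3 h6 hx).ne') hlm
  have hflow : fm b * (lm b)⁻¹ - κ * (G * q b) = fm a * (lm a)⁻¹ - κ * (G * q a) := by
    refine Negl.const (T := T) (Φ := fun x => fm x * (lm x)⁻¹ - κ * (G * q x))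
      ((((hinv.mul cfm).add ((h2.mul cα).mul cβ)).add
        ((hpot.negl_q.add ((hinv.mul cβ).const_mul G⁻¹)).const_mul
          (-(κ * G)))).add (negl_mul_increment cfm hα) |>.congr
        fun x y hx hxy hy => ?_) hb ha
    have hx' : x ∈ Icc a b := ⟨hx, hxy.trans hy⟩
    have e1 := hκ x hx'
    have e2 : lm x * (lm x)⁻¹ = 1 := mul_inv_cancel₀ (A3.lm_pos h3 h6 hx').ne'
    have e3 : lp x * (lp x)⁻¹ = 1 := mul_inv_cancel₀ (A3.lp_pos h3 h6 hx').ne'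
    have e4 : G * G⁻¹ = 1 := mul_inv_cancel₀ hpot.G_pos.ne'
    linear_combination (-(lm y - lm x) * (lm x)⁻¹ ^ 2 * (lp x)⁻¹) * e1 +
      ((lm y - lm x) * fm x * (lm x)⁻¹ ^ 2 - (lm x)⁻¹ * (fm y - fm x)) * e3 +
      ((lm y - lm x) * (lm x)⁻¹ * (lp x)⁻¹ * fp x) * e2 +
      ((lm y - lm x) * κ * (lp x)⁻¹ * (lm x)⁻¹ ^ 2) * e4
  have hqa : q a = G⁻¹ * ((lm a)⁻¹ * (lp a)⁻¹) := by
    have := hpot.add_eq a ha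
    rw [hpot.p_left] at this
    linarith
  rw [hqa, hpot.q_right, hfm] at hflow
  have e2 : lm a * (lm a)⁻¹ = 1 := mul_inv_cancel₀ (A3.lm_pos h3 h6 ha).ne'
  have e3 : lp a * (lp a)⁻¹ = 1 := mul_inv_cancel₀ (A3.lp_pos h3 h6 ha).ne'
  have e4 : G⁻¹ * G = 1 := inv_mul_cancel₀ hpot.G_pos.ne'
  have hκa : fm a * lp a + lm a = κ := by
    change _ = fm a * lp a + fp a * lm a
    rw [hfp, one_mul]
  have hκG : κ = G⁻¹ * ((lm b)⁻¹ + (lp a)⁻¹) := by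
    linear_combination (-G⁻¹) * hflow - κ * e4 + (G⁻¹ * κ * (lm a)⁻¹ * (lp a)⁻¹) * e4 +
      (-G⁻¹ * (lm a)⁻¹ * (lp a)⁻¹) * hκa +
      (G⁻¹ * (lm a)⁻¹ * fm a) * e3 + (G⁻¹ * (lp a)⁻¹) * e2
  rw [← hκG]
  constructor
  · linear_combination (-fm a) * e3 + (lp a)⁻¹ * hκa
  · have e5 : lm b * (lm b)⁻¹ = 1 := mul_inv_cancel₀ (A3.lm_pos h3 h6 hb).ne'
    rw [hfm] at hκb
    linear_combination (-fp b) * e5 + (lm b)⁻¹ * hκb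

end Potentials

section Arrivals

variable {a b : ℝ} {T : Measure ℝ} {lm lp : ℝ → ℝ} {μm μp : Measure ℝ} {G : ℝ} {p q : ℝ → ℝ}

lemma isFiniteMeasure_of_Icc {μ : Measure ℝ} {c : ℝ} (h : μ (Icc a b) = ENNReal.ofReal c)
    (h0 : μ (Icc a b)ᶜ = 0) : IsFiniteMeasure μ := by
  refine ⟨?_⟩
  rw [← measure_add_measure_compl (measurableSet_Icc (a := a) (b := b)), h, h0, add_zero]
  exact ENNReal.ofReal_lt_top

lemma ae_mem_Icc {μ : Measure ℝ} (h0 : μ (Icc a b)ᶜ = 0) : ∀ᵐ u ∂μ, u ∈ Icc a b :=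
  mem_ae_iff.2 h0

lemma real_Icc_right (h3 : A3 a b lm lp) (hμ : IsMuMinus a b lm μm) {x : ℝ} (hx : x ∈ Icc a b) :
    μm.real (Icc x b) = lm x := by
  rw [measureReal_def, hμ.1 x hx, ENNReal.toReal_ofReal (h3.2.2.2.2.1 x hx)]

lemma real_Icc_left (h3 : A3 a b lm lp) (hμ : IsMuPlus a b lp μp) {x : ℝ} (hx : x ∈ Icc a b) :
    μp.real (Icc a x) = lp x := by
  rw [measureReal_def, hμ.1 x hx, ENNReal.toReal_ofReal (h3.2.2.2.2.2 x hx)]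

lemma real_Ico [IsFiniteMeasure μm] (h3 : A3 a b lm lp) (hμ : IsMuMinus a b lm μm) {x y : ℝ}
    (hx : a ≤ x) (hxy : x ≤ y) (hy : y ≤ b) : μm.real (Ico x y) = lm x - lm y := by
  have h1 := real_Icc_right h3 hμ ⟨hx, hxy.trans hy⟩
  rw [← Ico_union_Icc_eq_Icc hxy hy, measureReal_union _ measurableSet_Icc,
    real_Icc_right h3 hμ ⟨hx.trans hxy, hy⟩] at h1
  · linarith
  · exact Set.disjoint_left.2 fun t ht ht' => not_lt.2 ht'.1 ht.2

lemma real_Ioc [IsFiniteMeasure μp] (h3 : A3 a b lm lp) (hμ : IsMuPlus a b lp μp) {x y : ℝ}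
    (hx : a ≤ x) (hxy : x ≤ y) (hy : y ≤ b) : μp.real (Ioc x y) = lp y - lp x := by
  have h1 := real_Icc_left h3 hμ ⟨hx.trans hxy, hy⟩
  rw [← Icc_union_Ioc_eq_Icc hx hxy, measureReal_union _ measurableSet_Ioc,
    real_Icc_left h3 hμ ⟨hx, hxy.trans hy⟩] at h1
  · linarith
  · exact Set.disjoint_left.2 fun t ht ht' => not_lt.2 ht.2 ht'.1

lemma measure_left_eq_zero [IsFiniteMeasure μm] (hab : a < b) (h3 : A3 a b lm lp)
    (hμ : IsMuMinus a b lm μm) : μm {a} = 0 := by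
  rw [← measureReal_eq_zero_iff]
  have h1 : Tendsto (fun y => lm a - lm y) (𝓝[>] a) (𝓝 (lm a - lm a)) := by
    refine tendsto_const_nhds.sub ?_
    have h := h3.1 a (left_mem_Icc.2 hab.le)
    rw [← nhdsWithin_Ioc_eq_nhdsGT hab]
    exact h.mono_left (nhdsWithin_mono _ Ioc_subset_Icc_self)
  rw [sub_self] at h1
  refine le_antisymm (ge_of_tendsto h1 ?_) measureReal_nonneg
  filter_upwards [Ioc_mem_nhdsGT hab] with y hy
  rw [← real_Ico h3 hμ le_rfl hy.1.le hy.2]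
  exact measureReal_mono (singleton_subset_iff.2 ⟨le_rfl, hy.1⟩)

lemma measure_right_eq_zero [IsFiniteMeasure μp] (hab : a < b) (h3 : A3 a b lm lp)
    (hμ : IsMuPlus a b lp μp) : μp {b} = 0 := by
  rw [← measureReal_eq_zero_iff]
  have h1 : Tendsto (fun y => lp b - lp y) (𝓝[<] b) (𝓝 (lp b - lp b)) := by
    refine tendsto_const_nhds.sub ?_
    have h := h3.2.1 b (right_mem_Icc.2 hab.le)
    rw [← nhdsWithin_Ico_eq_nhdsLT hab]
    exact h.mono_left (nhdsWithin_mono _ Ico_subset_Icc_self)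
  rw [sub_self] at h1
  refine le_antisymm (ge_of_tendsto h1 ?_) measureReal_nonneg
  filter_upwards [Ico_mem_nhdsLT hab] with y hy
  rw [← real_Ioc h3 hμ hy.1 hy.2.le le_rfl]
  exact measureReal_mono (singleton_subset_iff.2 ⟨hy.2, le_rfl⟩)

lemma real_Ioo_left [IsFiniteMeasure μm] (hab : a < b) (h3 : A3 a b lm lp)
    (hμ : IsMuMinus a b lm μm) {y : ℝ} (hy : y ∈ Icc a b) :
    μm.real (Ioo a y) = lm a - lm y := by
  rw [← real_Ico h3 hμ le_rfl hy.1 hy.2]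
  exact measureReal_congr (Ioo_ae_eq_Ico' (measure_left_eq_zero hab h3 hμ))

lemma real_Ioo_right [IsFiniteMeasure μp] (hab : a < b) (h3 : A3 a b lm lp)
    (hμ : IsMuPlus a b lp μp) {x : ℝ} (hx : x ∈ Icc a b) :
    μp.real (Ioo x b) = lp b - lp x := by
  rw [← real_Ioc h3 hμ hx.1 hx.2 le_rfl]
  exact measureReal_congr (Ioo_ae_eq_Ioc' (measure_right_eq_zero hab h3 hμ))

lemma IsPotential.setIntegral_p [IsFiniteMeasure T] [IsFiniteMeasure μm] (hab : a < b)
    (h3 : A3 a b lm lp) (h6 : A6 a b lm lp) (hpot : IsPotential a b T lm lp G p q)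
    (hlm : ∀ x y, a ≤ x → x ≤ y → y ≤ b → |lm y - lm x| ≤ T.real (Ioc x y))
    (hμ : IsMuMinus a b lm μm) {y : ℝ} (hy : y ∈ Icc a b) :
    ∫ t in Ioo a y, p t ∂μm = (1 - q a) * lm a - (1 - q y) * lm y := by
  rw [setIntegral_congr_set (Ioo_ae_eq_Ico' (measure_left_eq_zero hab h3 hμ))]
  have hI : Negl a b T fun x y =>
      ((∫ t in Ico a y, p t ∂μm) - ∫ t in Ico a x, p t ∂μm) + p x * (lm y - lm x) := by
    intro η hη
    obtain ⟨δ, hδ, H⟩ := exists_delta hpot.cont_p hη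
    refine ⟨δ, hδ, fun x y h1 h2 h4 h5 => ?_⟩
    have hint : ∀ u v, a ≤ u → v ≤ b → IntegrableOn p (Ico u v) μm := fun u v hu hv =>
      integrableOn_of_continuousOn hpot.cont_p fun t ht => ⟨hu.trans ht.1, ht.2.le.trans hv⟩
    have e : ∫ t in Ico a y, p t ∂μm = (∫ t in Ico a x, p t ∂μm) + ∫ t in Ico x y, p t ∂μm := by
      rw [← Ico_union_Ico_eq_Ico h1 h2, setIntegral_union (Ico_disjoint_Ico_same)
        measurableSet_Ico (hint a x le_rfl (h2.trans h4)) (hint x y h1 h4)]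
    have key := abs_setIntegral_sub_le (c := p x) (η := η) (hint x y h1 h4) fun t ht =>
      (H x ⟨h1, h2.trans h4⟩ t ⟨h1.trans ht.1, ht.2.le.trans h4⟩ (by
        rw [abs_of_nonneg (by linarith [ht.1])]; linarith [ht.2])).le
    rw [real_Ico h3 hμ h1 h2 h4] at key
    have h7 := hlm x y h1 h2 h4
    rw [abs_sub_comm] at h7
    have h8 := mul_le_mul_of_nonneg_left ((le_abs_self _).trans h7) hη.le
    refine le_trans (le_of_eq ?_) (key.trans h8)
    dsimp only
    rw [e]
    congr 1
    ring
  have := hpot.flow_minus_const h3 h6 hlm hI hy (left_mem_Icc.2 hab.le)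
  simp only [Ico_self, setIntegral_empty, zero_add] at this
  linarith

lemma IsPotential.setIntegral_q [IsFiniteMeasure T] [IsFiniteMeasure μp] (hab : a < b)
    (h3 : A3 a b lm lp) (h6 : A6 a b lm lp) (hpot : IsPotential a b T lm lp G p q)
    (hlp : ∀ x y, a ≤ x → x ≤ y → y ≤ b → |lp y - lp x| ≤ T.real (Ioc x y))
    (hμ : IsMuPlus a b lp μp) {x : ℝ} (hx : x ∈ Icc a b) :
    ∫ t in Ioo x b, q t ∂μp = (1 - p b) * lp b - (1 - p x) * lp x := by
  rw [setIntegral_congr_set (Ioo_ae_eq_Ioc' (measure_right_eq_zero hab h3 hμ))]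
  have hI : Negl a b T fun x y =>
      ((∫ t in Ioc y b, q t ∂μp) - ∫ t in Ioc x b, q t ∂μp) + q x * (lp y - lp x) := by
    intro η hη
    obtain ⟨δ, hδ, H⟩ := exists_delta hpot.cont_q hη
    refine ⟨δ, hδ, fun x y h1 h2 h4 h5 => ?_⟩
    have hint : ∀ u v, a ≤ u → v ≤ b → IntegrableOn q (Ioc u v) μp := fun u v hu hv =>
      integrableOn_of_continuousOn hpot.cont_q fun t ht => ⟨hu.trans ht.1.le, ht.2.trans hv⟩
    have e : ∫ t in Ioc x b, q t ∂μp = (∫ t in Ioc x y, q t ∂μp) + ∫ t in Ioc y b, q t ∂μp := by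
      rw [← Ioc_union_Ioc_eq_Ioc h2 h4, setIntegral_union (Ioc_disjoint_Ioc_of_le le_rfl)
        measurableSet_Ioc (hint x y h1 h4) (hint y b (h1.trans h2) le_rfl)]
    have key := abs_setIntegral_sub_le (c := q x) (η := η) (hint x y h1 h4) fun t ht =>
      (H x ⟨h1, h2.trans h4⟩ t ⟨h1.trans ht.1.le, ht.2.trans h4⟩ (by
        rw [abs_of_nonneg (by linarith [ht.1])]; linarith [ht.2])).le
    rw [real_Ioc h3 hμ h1 h2 h4] at key
    have h8 := mul_le_mul_of_nonneg_left ((le_abs_self _).trans (hlp x y h1 h2 h4)) hη.le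
    refine le_trans (le_of_eq ?_) (key.trans h8)
    dsimp only
    rw [e, ← abs_neg]
    congr 1
    ring
  have := hpot.flow_plus_const h3 h6 hlp hI hx (right_mem_Icc.2 hab.le)
  simp only [Ioc_self, setIntegral_empty, zero_add] at this
  linarith

end Arrivals

section Book

variable {a b : ℝ} {X : OrderBook} {wm wp : ℝ → ℝ} {μ : Measure ℝ}

lemma finite_setOf_mem (m : Multiset ℝ) : {x | x ∈ m}.Finite := by
  classical
  exact m.toFinset.finite_toSet.subset fun x hx => by simpa using hx

lemma Mplus_mem_insert : Mplus b X ∈ insert b {x | x ∈ X.plus} :=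
  (insert_nonempty _ _).csInf_mem ((finite_setOf_mem _).insert b)

lemma Mminus_mem_insert : Mminus a X ∈ insert a {x | x ∈ X.minus} :=
  (insert_nonempty _ _).csSup_mem ((finite_setOf_mem _).insert a)

lemma Mplus_le {y : ℝ} (hy : y ∈ X.plus) : Mplus b X ≤ y :=
  csInf_le ((finite_setOf_mem _).insert b).bddBelow (mem_insert_of_mem _ hy)

lemma le_Mminus {x : ℝ} (hx : x ∈ X.minus) : x ≤ Mminus a X :=
  le_csSup ((finite_setOf_mem _).insert a).bddAbove (mem_insert_of_mem _ hx)

lemma Mplus_mem (hX : IsConfig a b X) (h : X.plus ≠ 0) : Mplus b X ∈ X.plus := by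
  obtain ⟨y, hy⟩ := Multiset.exists_mem_of_ne_zero h
  rcases Mplus_mem_insert (b := b) (X := X) with h1 | h1
  · exact absurd h1 ((Mplus_le hy).trans_lt (hX.2.1 y hy).2).ne
  · exact h1

lemma Mminus_mem (hX : IsConfig a b X) (h : X.minus ≠ 0) : Mminus a X ∈ X.minus := by
  obtain ⟨y, hy⟩ := Multiset.exists_mem_of_ne_zero h
  rcases Mminus_mem_insert (a := a) (X := X) with h1 | h1
  · exact absurd h1 ((hX.1 y hy).1.trans_le (le_Mminus hy)).ne'
  · exact h1

lemma Mplus_eq (h : X.plus = 0) : Mplus b X = b := by simp [Mplus, h]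

lemma Mminus_eq (h : X.minus = 0) : Mminus a X = a := by simp [Mminus, h]

lemma Mplus_mem_Ioc (hab : a < b) (hX : IsConfig a b X) : Mplus b X ∈ Ioc a b := by
  by_cases h : X.plus = 0
  · rw [Mplus_eq h]; exact ⟨hab, le_rfl⟩
  · exact Ioo_subset_Ioc_self (hX.2.1 _ (Mplus_mem hX h))

lemma Mminus_mem_Ico (hab : a < b) (hX : IsConfig a b X) : Mminus a X ∈ Ico a b := by
  by_cases h : X.minus = 0
  · rw [Mminus_eq h]; exact ⟨le_rfl, hab⟩
  · exact Ioo_subset_Ico_self (hX.1 _ (Mminus_mem hX h))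

open scoped Classical in
lemma sum_map_erase {m : Multiset ℝ} {x : ℝ} (hx : x ∈ m) (w : ℝ → ℝ) :
    ((m.erase x).map w).sum = (m.map w).sum - w x := by
  conv_rhs => rw [← Multiset.cons_erase hx, Multiset.map_cons, Multiset.sum_cons]
  ring

open scoped Classical in
lemma linF_Lminus_sub (hab : a < b) (hX : IsConfig a b X) {u : ℝ} (hu : u ∈ Icc a b) :
    linF wm wp (Lminus a b u X) - linF wm wp X =
      (Ioo a (Mplus b X)).indicator wm u +
        (Icc (Mplus b X) b).indicator (fun _ => if X.plus = 0 then 0 else -wp (Mplus b X)) u := by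
  have hM := Mplus_mem_Ioc hab hX
  by_cases h1 : Mplus b X ≤ u
  · rw [indicator_of_notMem (fun h => not_lt.2 h1 h.2), indicator_of_mem (s := Icc (Mplus b X) b) ⟨h1, hu.2⟩]
    by_cases h2 : X.plus = 0
    · have : ¬u < b := not_lt.2 ((Mplus_eq (b := b) h2).ge.trans h1)
      simp [Lminus, h2, this]
    · simp [Lminus, h2, h1, linF, sum_map_erase (Mplus_mem hX h2)]
  · rw [indicator_of_notMem (fun h => h1 h.1) (s := Icc (Mplus b X) b)]
    rcases hu.1.eq_or_lt with rfl | h3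
    · simp [Lminus, h1]
    · have h4 : u < Mplus b X := not_le.1 h1
      rw [indicator_of_mem (s := Ioo a (Mplus b X)) ⟨h3, h4⟩]
      simp [Lminus, h1, h3, h4.trans_le hM.2, linF]

open scoped Classical in
lemma linF_Lplus_sub (hab : a < b) (hX : IsConfig a b X) {u : ℝ} (hu : u ∈ Icc a b) :
    linF wm wp (Lplus a b u X) - linF wm wp X =
      (Ioo (Mminus a X) b).indicator wp u +
        (Icc a (Mminus a X)).indicator
          (fun _ => if X.minus = 0 then 0 else -wm (Mminus a X)) u := by
  have hM := Mminus_mem_Ico hab hX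
  by_cases h1 : u ≤ Mminus a X
  · rw [indicator_of_notMem (fun h => not_lt.2 h1 h.1), indicator_of_mem (s := Icc a (Mminus a X)) ⟨hu.1, h1⟩]
    by_cases h2 : X.minus = 0
    · have : ¬a < u := not_lt.2 (h1.trans (Mminus_eq (a := a) h2).le)
      simp [Lplus, h2, this]
    · simp [Lplus, h2, h1, linF, sum_map_erase (Mminus_mem hX h2)]
  · rw [indicator_of_notMem (fun h => h1 h.2) (s := Icc a (Mminus a X))]
    rcases hu.2.eq_or_lt with rfl | h3
    · simp [Lplus, h1]
    · have h4 : Mminus a X < u := not_le.1 h1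
      rw [indicator_of_mem (s := Ioo (Mminus a X) b) ⟨h4, h3⟩]
      simp [Lplus, h1, h3, hM.1.trans_lt h4, linF]

open scoped Classical in
lemma integrable_linF_Lminus_sub [IsFiniteMeasure μ] (hab : a < b) (hX : IsConfig a b X)
    (hμ : μ (Icc a b)ᶜ = 0) (hw : ContinuousOn wm (Icc a b)) :
    Integrable (fun u => linF wm wp (Lminus a b u X) - linF wm wp X) μ ∧
    ∫ u, (linF wm wp (Lminus a b u X) - linF wm wp X) ∂μ =
      (∫ u in Ioo a (Mplus b X), wm u ∂μ) +
        (if X.plus = 0 then 0 else -wp (Mplus b X)) * μ.real (Icc (Mplus b X) b) := by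
  have hM := Mplus_mem_Ioc hab hX
  have he : (fun u => linF wm wp (Lminus a b u X) - linF wm wp X) =ᵐ[μ] fun u =>
      (Ioo a (Mplus b X)).indicator wm u +
        (Icc (Mplus b X) b).indicator (fun _ => if X.plus = 0 then 0 else -wp (Mplus b X)) u :=
    (ae_mem_Icc hμ).mono fun u hu => linF_Lminus_sub hab hX hu
  have h1 : Integrable ((Ioo a (Mplus b X)).indicator wm) μ :=
    (integrableOn_of_continuousOn hw fun t ht => ⟨ht.1.le, ht.2.le.trans hM.2⟩).integrable_indicator
      measurableSet_Ioo
  have h2 : Integrable ((Icc (Mplus b X) b).indicator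
      (fun _ => if X.plus = 0 then 0 else -wp (Mplus b X))) μ :=
    (integrable_const _).indicator measurableSet_Icc
  refine ⟨(h1.add h2).congr he.symm, ?_⟩
  rw [integral_congr_ae he, integral_add h1 h2, integral_indicator measurableSet_Ioo,
    integral_indicator measurableSet_Icc, setIntegral_const, smul_eq_mul, mul_comm (μ.real _)]

open scoped Classical in
lemma integrable_linF_Lplus_sub [IsFiniteMeasure μ] (hab : a < b) (hX : IsConfig a b X)
    (hμ : μ (Icc a b)ᶜ = 0) (hw : ContinuousOn wp (Icc a b)) :
    Integrable (fun u => linF wm wp (Lplus a b u X) - linF wm wp X) μ ∧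
    ∫ u, (linF wm wp (Lplus a b u X) - linF wm wp X) ∂μ =
      (∫ u in Ioo (Mminus a X) b, wp u ∂μ) +
        (if X.minus = 0 then 0 else -wm (Mminus a X)) * μ.real (Icc a (Mminus a X)) := by
  have hM := Mminus_mem_Ico hab hX
  have he : (fun u => linF wm wp (Lplus a b u X) - linF wm wp X) =ᵐ[μ] fun u =>
      (Ioo (Mminus a X) b).indicator wp u +
        (Icc a (Mminus a X)).indicator
          (fun _ => if X.minus = 0 then 0 else -wm (Mminus a X)) u :=
    (ae_mem_Icc hμ).mono fun u hu => linF_Lplus_sub hab hX hu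
  have h1 : Integrable ((Ioo (Mminus a X) b).indicator wp) μ :=
    (integrableOn_of_continuousOn hw fun t ht => ⟨hM.1.trans ht.1.le, ht.2.le⟩).integrable_indicator
      measurableSet_Ioo
  have h2 : Integrable ((Icc a (Mminus a X)).indicator
      (fun _ => if X.minus = 0 then 0 else -wm (Mminus a X))) μ :=
    (integrable_const _).indicator measurableSet_Icc
  refine ⟨(h1.add h2).congr he.symm, ?_⟩
  rw [integral_congr_ae he, integral_add h1 h2, integral_indicator measurableSet_Ioo,
    integral_indicator measurableSet_Icc, setIntegral_const, smul_eq_mul, mul_comm (μ.real _)]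

open scoped Classical in
lemma abs_linF_Lminus_sub_le (hab : a < b) (hX : IsConfig a b X) {C : ℝ}
    (hm : ∀ x ∈ Icc a b, |wm x| ≤ C) (hp : ∀ x ∈ Icc a b, |wp x| ≤ C) {u : ℝ} (hu : u ∈ Icc a b) :
    |linF wm wp (Lminus a b u X) - linF wm wp X| ≤ 2 * C := by
  have hM := Ioc_subset_Icc_self (Mplus_mem_Ioc hab hX)
  have hC : 0 ≤ C := (abs_nonneg _).trans (hm u hu)
  rw [linF_Lminus_sub hab hX hu, two_mul]
  refine (abs_add_le _ _).trans (add_le_add ?_ ?_) <;> rw [indicator_apply] <;> split_ifs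
  · exact hm u hu
  · simpa
  · simpa
  · simpa using hp _ hM
  · simpa

open scoped Classical in
lemma abs_linF_Lplus_sub_le (hab : a < b) (hX : IsConfig a b X) {C : ℝ}
    (hm : ∀ x ∈ Icc a b, |wm x| ≤ C) (hp : ∀ x ∈ Icc a b, |wp x| ≤ C) {u : ℝ} (hu : u ∈ Icc a b) :
    |linF wm wp (Lplus a b u X) - linF wm wp X| ≤ 2 * C := by
  have hM := Ico_subset_Icc_self (Mminus_mem_Ico hab hX)
  have hC : 0 ≤ C := (abs_nonneg _).trans (hm u hu)
  rw [linF_Lplus_sub hab hX hu, two_mul]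
  refine (abs_add_le _ _).trans (add_le_add ?_ ?_) <;> rw [indicator_apply] <;> split_ifs
  · exact hp u hu
  · simpa
  · simpa
  · simpa using hm _ hM
  · simpa

end Book

section Generator

variable {a b : ℝ} {T : Measure ℝ} {lm lp : ℝ → ℝ} {μm μp : Measure ℝ} {G : ℝ} {p q : ℝ → ℝ}
  {X : OrderBook}

open scoped Classical in
lemma IsPotential.genOp_minus [IsFiniteMeasure T] [IsFiniteMeasure μm] [IsFiniteMeasure μp]
    (hab : a < b) (h3 : A3 a b lm lp) (h6 : A6 a b lm lp) (hpot : IsPotential a b T lm lp G p q)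
    (hlm : ∀ x y, a ≤ x → x ≤ y → y ≤ b → |lm y - lm x| ≤ T.real (Ioc x y))
    (hlp : ∀ x y, a ≤ x → x ≤ y → y ≤ b → |lp y - lp x| ≤ T.real (Ioc x y))
    (hμm : IsMuMinus a b lm μm) (hμp : IsMuPlus a b lp μp) (hX : IsConfig a b X) :
    genOp a b μm μp (linF (fun x => p x / lp a) fun x => -((1 - q x) / lp a)) X =
      (if X.minus = 0 then 1 else 0) - (lp a)⁻¹ * (G⁻¹ * ((lm b)⁻¹ + (lp a)⁻¹) - lm a) := by
  have ha : a ∈ Icc a b := left_mem_Icc.2 hab.le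
  have hb : b ∈ Icc a b := right_mem_Icc.2 hab.le
  have hM := Ioc_subset_Icc_self (Mplus_mem_Ioc hab hX)
  have hM' := Ico_subset_Icc_self (Mminus_mem_Ico hab hX)
  have hc : ContinuousOn (fun x => -((1 - q x) / lp a)) (Icc a b) :=
    ((continuousOn_const.sub hpot.cont_q).div_const _).neg
  have e1 : lm a * (lm a)⁻¹ = 1 := mul_inv_cancel₀ (A3.lm_pos h3 h6 ha).ne'
  have e2 : lp a * (lp a)⁻¹ = 1 := mul_inv_cancel₀ (A3.lp_pos h3 h6 ha).ne'
  have e3 : lp b * (lp b)⁻¹ = 1 := mul_inv_cancel₀ (A3.lp_pos h3 h6 hb).ne'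
  have hqa := hpot.add_eq a ha
  have hpb := hpot.add_eq b hb
  rw [hpot.p_left] at hqa
  rw [hpot.q_right] at hpb
  have i1 : ∫ u in Ioo (Mminus a X) b, -((1 - q u) / lp a) ∂μp =
      -(lp b - lp (Mminus a X) - ((1 - p b) * lp b - (1 - p (Mminus a X)) * lp (Mminus a X)))
        / lp a := by
    have hint : IntegrableOn q (Ioo (Mminus a X) b) μp :=
      integrableOn_of_continuousOn hpot.cont_q fun t ht => ⟨hM'.1.trans ht.1.le, ht.2.le⟩
    rw [integral_neg, integral_div, integral_sub (integrable_const _) hint, setIntegral_const,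
      hpot.setIntegral_q hab h3 h6 hlp hμp hM', real_Ioo_right hab h3 hμp hM', smul_eq_mul,
      mul_one, neg_div]
  have c1 : (if X.plus = 0 then 0 else - -((1 - q (Mplus b X)) / lp a)) =
      (1 - q (Mplus b X)) / lp a := by
    split_ifs with h
    · rw [Mplus_eq h, hpot.q_right, sub_self, zero_div]
    · exact neg_neg _
  rw [genOp, (integrable_linF_Lminus_sub hab hX hμm.2 (hpot.cont_p.div_const _)).2,
    (integrable_linF_Lplus_sub hab hX hμp.2 hc).2, i1, c1, integral_div,
    hpot.setIntegral_p hab h3 h6 hlm hμm hM, real_Icc_right h3 hμm hM, real_Icc_left h3 hμp hM']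
  simp only [div_eq_mul_inv]
  split_ifs with h
  · rw [Mminus_eq h, hpot.p_left]
    linear_combination e2 + (-lm a * (lp a)⁻¹) * hqa - (lp b * (lp a)⁻¹) * hpb -
      (G⁻¹ * (lp a)⁻¹ ^ 2) * e1 - (G⁻¹ * (lm b)⁻¹ * (lp a)⁻¹) * e3
  · linear_combination (-lm a * (lp a)⁻¹) * hqa - (lp b * (lp a)⁻¹) * hpb -
      (G⁻¹ * (lp a)⁻¹ ^ 2) * e1 - (G⁻¹ * (lm b)⁻¹ * (lp a)⁻¹) * e3

open scoped Classical in
lemma IsPotential.genOp_plus [IsFiniteMeasure T] [IsFiniteMeasure μm] [IsFiniteMeasure μp]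
    (hab : a < b) (h3 : A3 a b lm lp) (h6 : A6 a b lm lp) (hpot : IsPotential a b T lm lp G p q)
    (hlm : ∀ x y, a ≤ x → x ≤ y → y ≤ b → |lm y - lm x| ≤ T.real (Ioc x y))
    (hlp : ∀ x y, a ≤ x → x ≤ y → y ≤ b → |lp y - lp x| ≤ T.real (Ioc x y))
    (hμm : IsMuMinus a b lm μm) (hμp : IsMuPlus a b lp μp) (hX : IsConfig a b X) :
    genOp a b μm μp (linF (fun x => -((1 - p x) / lm b)) fun x => q x / lm b) X =
      (if X.plus = 0 then 1 else 0) - (lm b)⁻¹ * (G⁻¹ * ((lm b)⁻¹ + (lp a)⁻¹) - lp b) := by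
  have ha : a ∈ Icc a b := left_mem_Icc.2 hab.le
  have hb : b ∈ Icc a b := right_mem_Icc.2 hab.le
  have hM := Ioc_subset_Icc_self (Mplus_mem_Ioc hab hX)
  have hM' := Ico_subset_Icc_self (Mminus_mem_Ico hab hX)
  have hc : ContinuousOn (fun x => -((1 - p x) / lm b)) (Icc a b) :=
    ((continuousOn_const.sub hpot.cont_p).div_const _).neg
  have e1 : lm a * (lm a)⁻¹ = 1 := mul_inv_cancel₀ (A3.lm_pos h3 h6 ha).ne'
  have e2 : lm b * (lm b)⁻¹ = 1 := mul_inv_cancel₀ (A3.lm_pos h3 h6 hb).ne'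
  have e3 : lp b * (lp b)⁻¹ = 1 := mul_inv_cancel₀ (A3.lp_pos h3 h6 hb).ne'
  have hqa := hpot.add_eq a ha
  have hpb := hpot.add_eq b hb
  rw [hpot.p_left] at hqa
  rw [hpot.q_right] at hpb
  have i1 : ∫ u in Ioo a (Mplus b X), -((1 - p u) / lm b) ∂μm =
      -(lm a - lm (Mplus b X) - ((1 - q a) * lm a - (1 - q (Mplus b X)) * lm (Mplus b X)))
        / lm b := by
    have hint : IntegrableOn p (Ioo a (Mplus b X)) μm :=
      integrableOn_of_continuousOn hpot.cont_p fun t ht => ⟨ht.1.le, ht.2.le.trans hM.2⟩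
    rw [integral_neg, integral_div, integral_sub (integrable_const _) hint, setIntegral_const,
      hpot.setIntegral_p hab h3 h6 hlm hμm hM, real_Ioo_left hab h3 hμm hM, smul_eq_mul,
      mul_one, neg_div]
  have c1 : (if X.minus = 0 then 0 else - -((1 - p (Mminus a X)) / lm b)) =
      (1 - p (Mminus a X)) / lm b := by
    split_ifs with h
    · rw [Mminus_eq h, hpot.p_left, sub_self, zero_div]
    · exact neg_neg _
  rw [genOp, (integrable_linF_Lminus_sub hab hX hμm.2 hc).2,
    (integrable_linF_Lplus_sub hab hX hμp.2 (hpot.cont_q.div_const _)).2, i1, c1, integral_div,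
    hpot.setIntegral_q hab h3 h6 hlp hμp hM', real_Icc_right h3 hμm hM, real_Icc_left h3 hμp hM']
  simp only [div_eq_mul_inv]
  split_ifs with h
  · rw [Mplus_eq h, hpot.q_right]
    linear_combination e2 + (-lm a * (lm b)⁻¹) * hqa - (lp b * (lm b)⁻¹) * hpb -
      (G⁻¹ * (lp a)⁻¹ * (lm b)⁻¹) * e1 - (G⁻¹ * (lm b)⁻¹ ^ 2) * e3
  · linear_combination (-lm a * (lm b)⁻¹) * hqa - (lp b * (lm b)⁻¹) * hpb -
      (G⁻¹ * (lp a)⁻¹ * (lm b)⁻¹) * e1 - (G⁻¹ * (lm b)⁻¹ ^ 2) * e3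

end Generator

section Lyapunov

variable {a b : ℝ} {T : Measure ℝ} {lm lp : ℝ → ℝ} {μ μm μp : Measure ℝ} {G : ℝ} {p q : ℝ → ℝ}
  {X : OrderBook}

lemma sqrt_sq_add_sq_le (x y x' y' : ℝ) :
    √(x' ^ 2 + y' ^ 2) ≤ √(x ^ 2 + y ^ 2) + (|x' - x| + |y' - y|) := by
  have hr : 0 ≤ √(x ^ 2 + y ^ 2) := Real.sqrt_nonneg _
  have hr2 : √(x ^ 2 + y ^ 2) ^ 2 = x ^ 2 + y ^ 2 := Real.sq_sqrt (by positivity)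
  have hx : |x| ≤ √(x ^ 2 + y ^ 2) := Real.abs_le_sqrt (by nlinarith)
  have hy : |y| ≤ √(x ^ 2 + y ^ 2) := Real.abs_le_sqrt (by nlinarith)
  rw [Real.sqrt_le_iff]
  refine ⟨by positivity, ?_⟩
  have h1 : x' ^ 2 = x ^ 2 + 2 * (x * (x' - x)) + |x' - x| ^ 2 := by rw [sq_abs]; ring
  have h2 : y' ^ 2 = y ^ 2 + 2 * (y * (y' - y)) + |y' - y| ^ 2 := by rw [sq_abs]; ring
  have h3 : x * (x' - x) ≤ √(x ^ 2 + y ^ 2) * |x' - x| :=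
    (le_abs_self _).trans ((abs_mul _ _).trans_le (by gcongr))
  have h4 : y * (y' - y) ≤ √(x ^ 2 + y ^ 2) * |y' - y| :=
    (le_abs_self _).trans ((abs_mul _ _).trans_le (by gcongr))
  have h5 : 0 ≤ |x' - x| * |y' - y| := by positivity
  nlinarith

lemma abs_sqrt_posPart_sub_le (x y x' y' : ℝ) :
    |√(max x' 0 ^ 2 + max y' 0 ^ 2) - √(max x 0 ^ 2 + max y 0 ^ 2)| ≤ |x' - x| + |y' - y| := by
  have h1 : |max x' 0 - max x 0| ≤ |x' - x| := abs_max_sub_max_le_abs _ _ _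
  have h2 : |max y' 0 - max y 0| ≤ |y' - y| := abs_max_sub_max_le_abs _ _ _
  have h3 := sqrt_sq_add_sq_le (max x 0) (max y 0) (max x' 0) (max y' 0)
  have h4 := sqrt_sq_add_sq_le (max x' 0) (max y' 0) (max x 0) (max y 0)
  rw [abs_sub_comm (max x 0), abs_sub_comm (max y 0)] at h4
  rw [abs_le]
  constructor <;> linarith

lemma posPart_sq_le (x x' : ℝ) : max x' 0 ^ 2 ≤ (max x 0 + (x' - x)) ^ 2 := by
  rcases le_total x' 0 with h | h
  · rw [max_eq_right h]; nlinarith [sq_nonneg (max x 0 + (x' - x))]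
  · rw [max_eq_left h]
    have := le_max_left x 0
    nlinarith

lemma sqrt_posPart_sub_le {x y : ℝ} (hr : 0 < √(max x 0 ^ 2 + max y 0 ^ 2)) (x' y' : ℝ) :
    √(max x' 0 ^ 2 + max y' 0 ^ 2) - √(max x 0 ^ 2 + max y 0 ^ 2) ≤
      (max x 0 * (x' - x) + max y 0 * (y' - y)) / √(max x 0 ^ 2 + max y 0 ^ 2) +
        ((x' - x) ^ 2 + (y' - y) ^ 2) / (2 * √(max x 0 ^ 2 + max y 0 ^ 2)) := by
  have h1 := posPart_sq_le x x'
  have h2 := posPart_sq_le y y'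
  have hr2 : √(max x 0 ^ 2 + max y 0 ^ 2) ^ 2 = max x 0 ^ 2 + max y 0 ^ 2 :=
    Real.sq_sqrt (by positivity)
  have hA : √(max x' 0 ^ 2 + max y' 0 ^ 2) ^ 2 = max x' 0 ^ 2 + max y' 0 ^ 2 :=
    Real.sq_sqrt (by positivity)
  set r := √(max x 0 ^ 2 + max y 0 ^ 2)
  set A := √(max x' 0 ^ 2 + max y' 0 ^ 2)
  rw [div_add_div _ _ hr.ne' (by positivity), le_div_iff₀ (by positivity)]
  have h3 : (A - r) * (2 * r) ≤
      2 * (max x 0 * (x' - x) + max y 0 * (y' - y)) + ((x' - x) ^ 2 + (y' - y) ^ 2) := by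
    nlinarith [sq_nonneg (A - r)]
  nlinarith [mul_le_mul_of_nonneg_left h3 hr.le]

lemma integrable_sqrt_posPart_sub {f g : ℝ → ℝ} {x y : ℝ}
    (hf : Integrable (fun u => f u - x) μ) (hg : Integrable (fun u => g u - y) μ) :
    Integrable (fun u => √(max (f u) 0 ^ 2 + max (g u) 0 ^ 2) - √(max x 0 ^ 2 + max y 0 ^ 2)) μ := by
  refine (hf.abs.add hg.abs).mono' ?_ (.of_forall fun u => abs_sqrt_posPart_sub_le _ _ _ _)
  have hc : Continuous fun z : ℝ × ℝ =>
      √(max (z.1 + x) 0 ^ 2 + max (z.2 + y) 0 ^ 2) - √(max x 0 ^ 2 + max y 0 ^ 2) := by fun_prop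
  simpa using hc.comp_aestronglyMeasurable (hf.aestronglyMeasurable.prodMk hg.aestronglyMeasurable)

lemma integral_sqrt_posPart_sub_le_const [IsFiniteMeasure μ] {f g : ℝ → ℝ} {x y C : ℝ}
    (hf' : ∀ᵐ u ∂μ, |f u - x| ≤ C) (hg' : ∀ᵐ u ∂μ, |g u - y| ≤ C) :
    ∫ u, (√(max (f u) 0 ^ 2 + max (g u) 0 ^ 2) - √(max x 0 ^ 2 + max y 0 ^ 2)) ∂μ ≤
      (C + C) * μ.real univ := by
  refine (Real.le_norm_self _).trans (norm_integral_le_of_norm_le_const ?_)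
  filter_upwards [hf', hg'] with u h1 h2
  exact (abs_sqrt_posPart_sub_le _ _ _ _).trans (add_le_add h1 h2)

lemma integral_sqrt_posPart_sub_le [IsFiniteMeasure μ] {f g : ℝ → ℝ} {x y C : ℝ}
    (hf : Integrable (fun u => f u - x) μ) (hg : Integrable (fun u => g u - y) μ)
    (hf' : ∀ᵐ u ∂μ, |f u - x| ≤ C) (hg' : ∀ᵐ u ∂μ, |g u - y| ≤ C)
    (hr : 0 < √(max x 0 ^ 2 + max y 0 ^ 2)) :
    ∫ u, (√(max (f u) 0 ^ 2 + max (g u) 0 ^ 2) - √(max x 0 ^ 2 + max y 0 ^ 2)) ∂μ ≤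
      (max x 0 * (∫ u, (f u - x) ∂μ) + max y 0 * ∫ u, (g u - y) ∂μ) /
        √(max x 0 ^ 2 + max y 0 ^ 2) + C ^ 2 / √(max x 0 ^ 2 + max y 0 ^ 2) * μ.real univ := by
  have h1 : Integrable (fun u => (max x 0 * (f u - x) + max y 0 * (g u - y)) /
      √(max x 0 ^ 2 + max y 0 ^ 2)) μ :=
    ((hf.const_mul _).add (hg.const_mul _)).div_const _
  have h2 : ∫ u, ((max x 0 * (f u - x) + max y 0 * (g u - y)) / √(max x 0 ^ 2 + max y 0 ^ 2) +
      C ^ 2 / √(max x 0 ^ 2 + max y 0 ^ 2)) ∂μ =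
      (max x 0 * (∫ u, (f u - x) ∂μ) + max y 0 * ∫ u, (g u - y) ∂μ) /
        √(max x 0 ^ 2 + max y 0 ^ 2) + C ^ 2 / √(max x 0 ^ 2 + max y 0 ^ 2) * μ.real univ := by
    rw [integral_add h1 (integrable_const _), integral_div,
      integral_add (hf.const_mul _) (hg.const_mul _), integral_const_mul, integral_const_mul,
      integral_const, smul_eq_mul, mul_comm (μ.real univ)]
  rw [← h2]
  refine integral_mono_ae (integrable_sqrt_posPart_sub hf hg) (h1.add (integrable_const _)) ?_
  filter_upwards [hf', hg'] with u h3 h4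
  refine (sqrt_posPart_sub_le hr _ _).trans (add_le_add_right ?_ _)
  rw [div_le_div_iff₀ (by positivity) hr]
  have h5 : (f u - x) ^ 2 ≤ C ^ 2 := sq_le_sq' (abs_le.1 h3).1 (abs_le.1 h3).2
  have h6 : (g u - y) ^ 2 ≤ C ^ 2 := sq_le_sq' (abs_le.1 h4).1 (abs_le.1 h4).2
  nlinarith

/-- The Lyapunov function built from the linear functionals with weights `v` and `w`. -/
def posNorm (vm vp wm wp : ℝ → ℝ) (X : OrderBook) : ℝ :=
  √(max (linF vm vp X) 0 ^ 2 + max (linF wm wp X) 0 ^ 2)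

variable {vm vp wm wp : ℝ → ℝ}

lemma genOp_posNorm_le_const [IsFiniteMeasure μm] [IsFiniteMeasure μp] (hab : a < b)
    (hμm : IsMuMinus a b lm μm) (hμp : IsMuPlus a b lp μp) (hX : IsConfig a b X) {C : ℝ}
    (hvm : ∀ x ∈ Icc a b, |vm x| ≤ C) (hvp : ∀ x ∈ Icc a b, |vp x| ≤ C)
    (hwm : ∀ x ∈ Icc a b, |wm x| ≤ C) (hwp : ∀ x ∈ Icc a b, |wp x| ≤ C) :
    genOp a b μm μp (posNorm vm vp wm wp) X ≤
      (2 * C + 2 * C) * μm.real univ + (2 * C + 2 * C) * μp.real univ :=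
  add_le_add
    (integral_sqrt_posPart_sub_le_const
      ((ae_mem_Icc hμm.2).mono fun _ hu => abs_linF_Lminus_sub_le hab hX hvm hvp hu)
      ((ae_mem_Icc hμm.2).mono fun _ hu => abs_linF_Lminus_sub_le hab hX hwm hwp hu))
    (integral_sqrt_posPart_sub_le_const
      ((ae_mem_Icc hμp.2).mono fun _ hu => abs_linF_Lplus_sub_le hab hX hvm hvp hu)
      ((ae_mem_Icc hμp.2).mono fun _ hu => abs_linF_Lplus_sub_le hab hX hwm hwp hu))

lemma genOp_posNorm_le [IsFiniteMeasure μm] [IsFiniteMeasure μp] (hab : a < b)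
    (hμm : IsMuMinus a b lm μm) (hμp : IsMuPlus a b lp μp) (hX : IsConfig a b X) {C : ℝ}
    (cvm : ContinuousOn vm (Icc a b)) (cvp : ContinuousOn vp (Icc a b))
    (cwm : ContinuousOn wm (Icc a b)) (cwp : ContinuousOn wp (Icc a b))
    (hvm : ∀ x ∈ Icc a b, |vm x| ≤ C) (hvp : ∀ x ∈ Icc a b, |vp x| ≤ C)
    (hwm : ∀ x ∈ Icc a b, |wm x| ≤ C) (hwp : ∀ x ∈ Icc a b, |wp x| ≤ C)
    (hr : 0 < posNorm vm vp wm wp X) :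
    genOp a b μm μp (posNorm vm vp wm wp) X ≤
      (max (linF vm vp X) 0 * genOp a b μm μp (linF vm vp) X +
        max (linF wm wp X) 0 * genOp a b μm μp (linF wm wp) X) / posNorm vm vp wm wp X +
      (2 * C) ^ 2 * (μm.real univ + μp.real univ) / posNorm vm vp wm wp X := by
  refine (add_le_add
    (integral_sqrt_posPart_sub_le
      (integrable_linF_Lminus_sub hab hX hμm.2 cvm).1 (integrable_linF_Lminus_sub hab hX hμm.2 cwm).1
      ((ae_mem_Icc hμm.2).mono fun _ hu => abs_linF_Lminus_sub_le hab hX hvm hvp hu)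
      ((ae_mem_Icc hμm.2).mono fun _ hu => abs_linF_Lminus_sub_le hab hX hwm hwp hu) hr)
    (integral_sqrt_posPart_sub_le
      (integrable_linF_Lplus_sub hab hX hμp.2 cvp).1 (integrable_linF_Lplus_sub hab hX hμp.2 cwp).1
      ((ae_mem_Icc hμp.2).mono fun _ hu => abs_linF_Lplus_sub_le hab hX hvm hvp hu)
      ((ae_mem_Icc hμp.2).mono fun _ hu => abs_linF_Lplus_sub_le hab hX hwm hwp hu) hr)).trans
    (le_of_eq ?_)
  simp only [genOp, posNorm]
  ring

lemma IsPotential.mem_unit (h3 : A3 a b lm lp) (h6 : A6 a b lm lp)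
    (hpot : IsPotential a b T lm lp G p q) {x : ℝ} (hx : x ∈ Icc a b) :
    p x ≤ 1 ∧ q x ≤ 1 ∧ 1 + G⁻¹ * ((lm a)⁻¹ * (lp b)⁻¹) ≤ p x + q x := by
  have ha : a ∈ Icc a b := left_mem_Icc.2 (hx.1.trans hx.2)
  have hb : b ∈ Icc a b := right_mem_Icc.2 (hx.1.trans hx.2)
  refine ⟨hpot.p_left ▸ hpot.anti_p ha hx hx.1, hpot.q_right ▸ hpot.mono_q hx hb hx.2, ?_⟩
  rw [hpot.add_eq x hx]
  have h1 := A3.monotoneOn_inv_lm h3 h6 ha hx hx.1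
  have h2 := A3.antitoneOn_inv_lp h3 h6 hx hb hx.2
  have h4 := A3.lm_pos h3 h6 hx
  have h5 := A3.lp_pos h3 h6 hb
  have h7 := hpot.G_pos
  simp only at h1 h2
  gcongr

lemma sum_map_nonpos {m : Multiset ℝ} {w : ℝ → ℝ} (h : ∀ x ∈ m, w x ≤ 0) :
    (m.map w).sum ≤ 0 := by
  simpa using Multiset.sum_map_le_sum_map w (fun _ => 0) h

lemma IsPotential.linF_nonpos_of_minus (h3 : A3 a b lm lp) (h6 : A6 a b lm lp)
    (hpot : IsPotential a b T lm lp G p q) (hX : IsConfig a b X) (h : X.minus = 0) :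
    linF (fun x => p x / lp a) (fun x => -((1 - q x) / lp a)) X ≤ 0 := by
  simp only [linF, h, Multiset.map_zero, Multiset.sum_zero, zero_add]
  refine sum_map_nonpos fun y hy => ?_
  have := (hpot.mem_unit h3 h6 (Ioo_subset_Icc_self (hX.2.1 y hy))).2.1
  exact neg_nonpos.2 (div_nonneg (by linarith) h6.1.le)

lemma IsPotential.linF_nonpos_of_plus (h3 : A3 a b lm lp) (h6 : A6 a b lm lp)
    (hpot : IsPotential a b T lm lp G p q) (hX : IsConfig a b X) (h : X.plus = 0) :
    linF (fun x => -((1 - p x) / lm b)) (fun x => q x / lm b) X ≤ 0 := by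
  simp only [linF, h, Multiset.map_zero, Multiset.sum_zero, add_zero]
  refine sum_map_nonpos fun y hy => ?_
  have := (hpot.mem_unit h3 h6 (Ioo_subset_Icc_self (hX.1 y hy))).1
  exact neg_nonpos.2 (div_nonneg (by linarith) h6.2.le)

lemma card_mul_le_sum_map {m : Multiset ℝ} {w : ℝ → ℝ} {δ : ℝ} (h : ∀ x ∈ m, δ ≤ w x) :
    δ * Multiset.card m ≤ (m.map w).sum := by
  have := Multiset.card_nsmul_le_sum (s := m.map w) (a := δ) fun z hz => by
    obtain ⟨x, hx, rfl⟩ := Multiset.mem_map.1 hz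
    exact h x hx
  rwa [Multiset.card_map, nsmul_eq_mul, mul_comm] at this

lemma linF_combination (c d : ℝ) :
    c * linF vm vp X + d * linF wm wp X =
      linF (fun x => c * vm x + d * wm x) (fun x => c * vp x + d * wp x) X := by
  simp only [linF, Multiset.sum_map_add, Multiset.sum_map_mul_left]
  ring

/-- Linear growth of the Lyapunov function in the number of orders. -/
lemma IsPotential.card_le_posNorm (hab : a < b) (h3 : A3 a b lm lp) (h6 : A6 a b lm lp)
    (hpot : IsPotential a b T lm lp G p q) (hX : IsConfig a b X) :
    G⁻¹ * ((lm a)⁻¹ * (lp b)⁻¹) * (Multiset.card X.minus + Multiset.card X.plus) ≤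
      2 * (lp a + lm b) * posNorm (fun x => p x / lp a) (fun x => -((1 - q x) / lp a))
        (fun x => -((1 - p x) / lm b)) (fun x => q x / lm b) X := by
  have hm := Ico_subset_Icc_self (Mminus_mem_Ico hab hX)
  have hsep : ∀ y ∈ X.plus, Mminus a X ≤ y := fun y hy => by
    by_cases h : X.minus = 0
    · rw [Mminus_eq h]; exact (hX.2.1 y hy).1.le
    · exact (hX.2.2 _ (Mminus_mem hX h) y hy).le
  set m := Mminus a X
  set F₁ := linF (fun x => p x / lp a) (fun x => -((1 - q x) / lp a)) X with hF₁
  set F₂ := linF (fun x => -((1 - p x) / lm b)) (fun x => q x / lm b) X with hF₂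
  set δ := G⁻¹ * ((lm a)⁻¹ * (lp b)⁻¹)
  obtain ⟨hP, hQ, hPQ⟩ := hpot.mem_unit h3 h6 hm
  have hδ : 0 ≤ δ := by
    have h1 := A3.lm_pos h3 h6 (left_mem_Icc.2 hab.le)
    have h2 := A3.lp_pos h3 h6 (right_mem_Icc.2 hab.le)
    have h4 := hpot.G_pos
    positivity
  have hla := h6.1
  have hlb := h6.2
  have key : δ * (Multiset.card X.minus + Multiset.card X.plus) ≤
      (q m + 1 - p m) * lp a * F₁ + (p m + 1 - q m) * lm b * F₂ := by
    rw [hF₁, hF₂, linF_combination, linF, mul_add]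
    refine add_le_add (card_mul_le_sum_map fun x hx => ?_) (card_mul_le_sum_map fun y hy => ?_)
    · have h1 := hpot.anti_p (Ioo_subset_Icc_self (hX.1 x hx)) hm (le_Mminus hx)
      have h2 : (q m + 1 - p m) * lp a * (p x / lp a) +
          (p m + 1 - q m) * lm b * -((1 - p x) / lm b) = 2 * p x - (p m + 1 - q m) := by
        field_simp
        ring
      rw [h2]; linarith
    · have h1 := hpot.mono_q hm (Ioo_subset_Icc_self (hX.2.1 y hy)) (hsep y hy)
      have h2 : (q m + 1 - p m) * lp a * -((1 - q y) / lp a) +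
          (p m + 1 - q m) * lm b * (q y / lm b) = 2 * q y - (q m + 1 - p m) := by
        field_simp
        ring
      rw [h2]; linarith
  have hV : posNorm (fun x => p x / lp a) (fun x => -((1 - q x) / lp a))
      (fun x => -((1 - p x) / lm b)) (fun x => q x / lm b) X =
      √(max F₁ 0 ^ 2 + max F₂ 0 ^ 2) := rfl
  rw [hV]
  have b1 : F₁ ≤ √(max F₁ 0 ^ 2 + max F₂ 0 ^ 2) :=
    (le_max_left _ _).trans (Real.le_sqrt_of_sq_le (by nlinarith [sq_nonneg (max F₂ 0)]))
  have b2 : F₂ ≤ √(max F₁ 0 ^ 2 + max F₂ 0 ^ 2) :=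
    (le_max_left _ _).trans (Real.le_sqrt_of_sq_le (by nlinarith [sq_nonneg (max F₁ 0)]))
  have b0 : 0 ≤ √(max F₁ 0 ^ 2 + max F₂ 0 ^ 2) := Real.sqrt_nonneg _
  set r := √(max F₁ 0 ^ 2 + max F₂ 0 ^ 2)
  have c1 : (q m + 1 - p m) * lp a * F₁ ≤ 2 * lp a * r :=
    (mul_le_mul_of_nonneg_left b1 (mul_nonneg (by linarith) hla.le)).trans
      (mul_le_mul_of_nonneg_right (by nlinarith) b0)
  have c2 : (p m + 1 - q m) * lm b * F₂ ≤ 2 * lm b * r :=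
    (mul_le_mul_of_nonneg_left b2 (mul_nonneg (by linarith) hlb.le)).trans
      (mul_le_mul_of_nonneg_right (by nlinarith) b0)
  linarith

end Lyapunov

section Main

variable {a b : ℝ}

lemma boundedVariationOn_of_monotoneOn {f : ℝ → ℝ} (hf : MonotoneOn f (Icc a b)) :
    BoundedVariationOn f (Icc a b) := by
  refine hf.boundedVariationOn (C := max |f a| |f b|) fun x hx => ?_
  have ha : a ∈ Icc a b := left_mem_Icc.2 (hx.1.trans hx.2)
  have hb : b ∈ Icc a b := right_mem_Icc.2 (hx.1.trans hx.2)
  exact abs_le_max_abs_abs (hf ha hx hx.1) (hf hx hb hx.2)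

lemma boundedVariationOn_of_antitoneOn {f : ℝ → ℝ} (hf : AntitoneOn f (Icc a b)) :
    BoundedVariationOn f (Icc a b) := by
  have h := boundedVariationOn_of_monotoneOn hf.neg
  have hl : LipschitzWith 1 (fun x : ℝ => -x) := LipschitzWith.id.neg
  simpa [Function.comp_def] using hl.comp_boundedVariationOn h

/-- All the objects of the model live over one common dominating measure `T`, and the values of
Luckock's solution at the far endpoints are explicit. -/
lemma exists_dominating_measure (hab : a < b) {lm lp fm fp : ℝ → ℝ} (h3 : A3 a b lm lp)
    (h6 : A6 a b lm lp) (hsol : LuckockSol a b lm lp fm fp) {νip νim : SignedMeasure ℝ}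
    (hνip : IsLS a b (fun x => (lp x)⁻¹) νip) (hνim : IsLS a b (fun x => (lm x)⁻¹) νim) :
    ∃ T : Measure ℝ, IsFiniteMeasure T ∧
      (∀ x y, a ≤ x → x ≤ y → y ≤ b → |lm y - lm x| ≤ T.real (Ioc x y)) ∧
      (∀ x y, a ≤ x → x ≤ y → y ≤ b → |lp y - lp x| ≤ T.real (Ioc x y)) ∧
      IsPotential a b T lm lp (Gam a b lm lp νip) (ump a b lm lp νip) (upm a b lm lp νip νim) ∧
      fm a = (lp a)⁻¹ * ((Gam a b lm lp νip)⁻¹ * ((lm b)⁻¹ + (lp a)⁻¹) - lm a) ∧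
      fp b = (lm b)⁻¹ * ((Gam a b lm lp νip)⁻¹ * ((lm b)⁻¹ + (lp a)⁻¹) - lp b) := by
  have ⟨clm, clp, mlm, mlp, _, _⟩ := h3
  obtain ⟨cfm, cfp, bfm, bfp, hfm, hfp, heq⟩ := hsol
  obtain ⟨νlm, hνlm⟩ := exists_isLS hab.le clm (boundedVariationOn_of_antitoneOn mlm)
  obtain ⟨νlp, hνlp⟩ := exists_isLS hab.le clp (boundedVariationOn_of_monotoneOn mlp)
  obtain ⟨νfm, hνfm⟩ := exists_isLS hab.le cfm bfm
  obtain ⟨νfp, hνfp⟩ := exists_isLS hab.le cfp bfp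
  have heq' := heq νlm νlp νfm νfp hνlm hνlp hνfm hνfp
  let T₁ := νip.totalVariation + νim.totalVariation
  let T₂ := νlm.totalVariation + νlp.totalVariation
  let T₃ := νfm.totalVariation + νfp.totalVariation
  let T := T₁ + (T₂ + T₃)
  have hT₁ : T₁ ≤ T := Measure.le_add_right le_rfl
  have hT₂ : T₂ ≤ T := Measure.le_add_left (Measure.le_add_right le_rfl)
  have hT₃ : T₃ ≤ T := Measure.le_add_left (Measure.le_add_left le_rfl)
  have tip : νip.totalVariation ≤ T := (Measure.le_add_right le_rfl).trans hT₁
  have tim : νim.totalVariation ≤ T := (Measure.le_add_left le_rfl).trans hT₁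
  have tlm : νlm.totalVariation ≤ T := (Measure.le_add_right le_rfl).trans hT₂
  have tlp : νlp.totalVariation ≤ T := (Measure.le_add_left le_rfl).trans hT₂
  have tfm : νfm.totalVariation ≤ T := (Measure.le_add_right le_rfl).trans hT₃
  have tfp : νfp.totalVariation ≤ T := (Measure.le_add_left le_rfl).trans hT₃
  have hpot := isPotential hab h3 h6 hνip hνim tip tim
  have hlm := abs_increment_le hνlm clm tlm
  have hlp := abs_increment_le hνlp clp tlp
  refine ⟨T, inferInstance, hlm, hlp, hpot, hpot.luckock_endpoints hab h3 h6 hlm hlp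
    (abs_increment_le hνim (A3.continuousOn_inv_lm h3 h6) tim) cfm cfp hfm hfp ?_ ?_⟩
  · refine (((negl_sInt hνlp clp tlp cfm).add (negl_sInt hνfp cfp tfp clm)).const_mul (-1)).congr
      fun x y _ _ _ => ?_
    linear_combination (heq' (Ioc x y) measurableSet_Ioc).1
  · refine (((negl_sInt hνlm clm tlm cfp).add (negl_sInt hνfm cfm tfm clp)).const_mul (-1)).congr
      fun x y _ _ _ => ?_
    linear_combination (heq' (Ioc x y) measurableSet_Ioc).2

lemma exists_common_bound {v₁ v₂ v₃ v₄ : ℝ → ℝ} (h₁ : ContinuousOn v₁ (Icc a b))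
    (h₂ : ContinuousOn v₂ (Icc a b)) (h₃ : ContinuousOn v₃ (Icc a b))
    (h₄ : ContinuousOn v₄ (Icc a b)) :
    ∃ C, (∀ x ∈ Icc a b, |v₁ x| ≤ C) ∧ (∀ x ∈ Icc a b, |v₂ x| ≤ C) ∧
      (∀ x ∈ Icc a b, |v₃ x| ≤ C) ∧ ∀ x ∈ Icc a b, |v₄ x| ≤ C := by
  obtain ⟨C, hC⟩ := isCompact_Icc.exists_bound_of_continuousOn
    (h₁.prodMk (h₂.prodMk (h₃.prodMk h₄)))
  simp only [Prod.norm_def, Real.norm_eq_abs, max_le_iff] at hC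
  exact ⟨C, fun x hx => (hC x hx).1, fun x hx => (hC x hx).2.1, fun x hx => (hC x hx).2.2.1,
    fun x hx => (hC x hx).2.2.2⟩

end Main

end Luckock

/-- Lyapunov function: under (A3) and (A6), if the unique solution
`(fm, fp)` of Luckock's equation satisfies `ε := min (fm a) (fp b) > 0`, then the
function `V` satisfies `GV(X) ≤ K` for some constant `K` and all configurations `X`,
and for every `ε' < ε` there is an `N` such that `GV(X) ≤ −ε'` whenever the total
number of orders in `X` is at least `N`.  Here `νip, νim` are the Lebesgue-Stieltjes
measures of `1/λ₊, 1/λ₋` on `[a,b]` and `μm, μp` the arrival measures. -/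
theorem stmt18 (a b : ℝ) (hab : a < b) (lm lp : ℝ → ℝ)
    (hA3 : A3 a b lm lp) (hA6 : A6 a b lm lp)
    (fm fp : ℝ → ℝ) (hsol : LuckockSol a b lm lp fm fp)
    (hε : 0 < min (fm a) (fp b))
    (μm μp : MeasureTheory.Measure ℝ)
    (hμm : IsMuMinus a b lm μm) (hμp : IsMuPlus a b lp μp)
    (νip νim : MeasureTheory.SignedMeasure ℝ)
    (hνip : IsLS a b (fun x => (lp x)⁻¹) νip)
    (hνim : IsLS a b (fun x => (lm x)⁻¹) νim) :
    (∃ K : ℝ, ∀ X : OrderBook, IsConfig a b X →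
      genOp a b μm μp (LyapV a b lm lp νip νim) X ≤ K) ∧
    ∀ ε' : ℝ, ε' < min (fm a) (fp b) →
      ∃ N : ℕ, ∀ X : OrderBook, IsConfig a b X →
        N ≤ Multiset.card X.minus + Multiset.card X.plus →
        genOp a b μm μp (LyapV a b lm lp νip νim) X ≤ -ε' := by
  have h := Luckock.exists_dominating_measure hab hA3 hA6 hsol hνip hνim
  obtain ⟨T, hT, hlm, hlp, hpot, hfm, hfp⟩ := h
  have hV : LyapV a b lm lp νip νim = Luckock.posNorm (fun x => ump a b lm lp νip x / lp a)
      (fun x => -((1 - upm a b lm lp νip νim x) / lp a))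
      (fun x => -((1 - ump a b lm lp νip x) / lm b))
      (fun x => upm a b lm lp νip νim x / lm b) := rfl
  rw [hV]
  set p := ump a b lm lp νip
  set q := upm a b lm lp νip νim
  set G := Gam a b lm lp νip
  have : IsFiniteMeasure μm :=
    Luckock.isFiniteMeasure_of_Icc (hμm.1 a (left_mem_Icc.2 hab.le)) hμm.2
  have : IsFiniteMeasure μp :=
    Luckock.isFiniteMeasure_of_Icc (hμp.1 b (right_mem_Icc.2 hab.le)) hμp.2
  have c₁ : ContinuousOn (fun x => p x / lp a) (Icc a b) := hpot.cont_p.div_const _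
  have c₂ : ContinuousOn (fun x => -((1 - q x) / lp a)) (Icc a b) :=
    ((continuousOn_const.sub hpot.cont_q).div_const _).neg
  have c₃ : ContinuousOn (fun x => -((1 - p x) / lm b)) (Icc a b) :=
    ((continuousOn_const.sub hpot.cont_p).div_const _).neg
  have c₄ : ContinuousOn (fun x => q x / lm b) (Icc a b) := hpot.cont_q.div_const _
  obtain ⟨C, b₁, b₂, b₃, b₄⟩ := Luckock.exists_common_bound c₁ c₂ c₃ c₄
  refine ⟨⟨_, fun X hX => Luckock.genOp_posNorm_le_const hab hμm hμp hX b₁ b₂ b₃ b₄⟩, ?_⟩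
  intro ε' hε'
  set ε := min (fm a) (fp b)
  set δ := G⁻¹ * ((lm a)⁻¹ * (lp b)⁻¹)
  set c := 2 * (lp a + lm b)
  set D := (2 * C) ^ 2 * (μm.real univ + μp.real univ)
  have hδ : 0 < δ := by
    have h1 := Luckock.A3.lm_pos hA3 hA6 (left_mem_Icc.2 hab.le)
    have h2 := Luckock.A3.lp_pos hA3 hA6 (right_mem_Icc.2 hab.le)
    have h4 := hpot.G_pos
    positivity
  have hc : 0 < c := by
    have := hA6.1
    have := hA6.2
    positivity
  have hD : 0 ≤ D := by positivity
  obtain ⟨N, hN⟩ := exists_nat_gt (c * (D / (ε - ε')) / δ)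
  refine ⟨N, fun X hX hcard => ?_⟩
  have hgrow := hpot.card_le_posNorm hab hA3 hA6 hX
  have hle := Luckock.genOp_posNorm_le hab hμm hμp hX c₁ c₂ c₃ c₄ b₁ b₂ b₃ b₄
  have hgm := hpot.genOp_minus hab hA3 hA6 hlm hlp hμm hμp hX
  have hgp := hpot.genOp_plus hab hA3 hA6 hlm hlp hμm hμp hX
  have hnm := hpot.linF_nonpos_of_minus hA3 hA6 hX
  have hnp := hpot.linF_nonpos_of_plus hA3 hA6 hX
  rw [← hfm] at hgm
  rw [← hfp] at hgp
  rw [hgm, hgp] at hle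
  set F₁ := linF (fun x => p x / lp a) (fun x => -((1 - q x) / lp a)) X with hF₁
  set F₂ := linF (fun x => -((1 - p x) / lm b)) (fun x => q x / lm b) X with hF₂
  have hr : Luckock.posNorm (fun x => p x / lp a) (fun x => -((1 - q x) / lp a))
      (fun x => -((1 - p x) / lm b)) (fun x => q x / lm b) X =
      √(max F₁ 0 ^ 2 + max F₂ 0 ^ 2) := rfl
  rw [hr] at hgrow hle
  have hsum : √(max F₁ 0 ^ 2 + max F₂ 0 ^ 2) ≤ max F₁ 0 + max F₂ 0 :=
    Real.sqrt_le_iff.2 ⟨by positivity, by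
      nlinarith [mul_nonneg (le_max_right F₁ 0) (le_max_right F₂ 0)]⟩
  set r := √(max F₁ 0 ^ 2 + max F₂ 0 ^ 2)
  have hεε : 0 < ε - ε' := sub_pos.2 hε'
  have hNcard : (N : ℝ) ≤ Multiset.card X.minus + Multiset.card X.plus := by exact_mod_cast hcard
  have hDr : D / (ε - ε') < r := by
    rw [div_lt_iff₀ hδ] at hN
    have h1 := mul_le_mul_of_nonneg_left hNcard hδ.le
    exact lt_of_mul_lt_mul_left (by linarith) hc.le
  have hr0 : 0 < r := (div_nonneg hD hεε.le).trans_lt hDr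
  refine (hle hr0).trans ?_
  have hdrift₁ : max F₁ 0 * ((if X.minus = 0 then 1 else 0) - fm a) ≤ max F₁ 0 * -ε := by
    split_ifs with h
    · simp [max_eq_right (hnm h)]
    · refine mul_le_mul_of_nonneg_left ?_ (le_max_right _ _)
      linarith [min_le_left (fm a) (fp b)]
  have hdrift₂ : max F₂ 0 * ((if X.plus = 0 then 1 else 0) - fp b) ≤ max F₂ 0 * -ε := by
    split_ifs with h
    · simp [max_eq_right (hnp h)]
    · refine mul_le_mul_of_nonneg_left ?_ (le_max_right _ _)
      linarith [min_le_right (fm a) (fp b)]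
  rw [div_lt_iff₀ hεε] at hDr
  rw [← add_div, div_le_iff₀ hr0]
  nlinarith [mul_le_mul_of_nonneg_left hsum hε.le]
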